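/- Let d ≥ 1, let 1 ≤ β < 2, let ν be a Lévy measure on ℝ^d with ∫_{‖x‖<1} ‖x‖^β ν(dx) < ∞ and let γ ∈ ℝ^d. Let (p_t)_{t≥0} be the marginal laws of the Lévy process with triplet (0, γ, ν), i.e. with characteristic exponent ψ(ξ) = −i⟨ξ, γ⟩ − ∫ (e^{i⟨ξ,y⟩} − 1 − i⟨ξ,y⟩ 1_{‖y‖≤1}) ν(dy). Let g be a bounded Borel function and μ a finite Borel measure on ℝ^d, and assume that r = g ∗ μ̌ is bounded and continuous, is differentiable at 0, and satisfies |r(x) − r(0) − ⟨x, ∇r(0)⟩| ≤ C‖x‖^β for all ‖x‖ < 1 and some constant C > 0. Then lim_{t→0+} t^{−1}(H_g^μ(t) − H_g^μ(0)) = ⟨γ, ∇r(0)⟩ + ∫_{ℝ^d} (r(x) − r(0) − ⟨x, ∇r(0)⟩ 1_{‖x‖≤1}) ν(dx), the integral on the right being absolutely convergent. -/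

import Mathlib

open MeasureTheory Filter
open scoped Topology RealInnerProductSpace ENNReal

section LevyKernel

variable {E : Type*} [NormedAddCommGroup E] [InnerProductSpace ℝ E]

/-- The map `z ↦ exp (-z)` is `1`-Lipschitz on the closed right half-plane. -/
lemma Complex.norm_exp_neg_sub_exp_neg_le {a b : ℂ} (ha : 0 ≤ a.re) (hb : 0 ≤ b.re) :
    ‖Complex.exp (-a) - Complex.exp (-b)‖ ≤ ‖a - b‖ := by
  have h := (convex_halfSpace_re_ge 0).norm_image_sub_le_of_norm_hasDerivWithin_le
    (f := fun z : ℂ => Complex.exp (-z)) (f' := fun z => Complex.exp (-z) * (-1)) (C := 1)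
    (fun z _ => ((Complex.hasDerivAt_exp (-z)).comp z (hasDerivAt_neg z)).hasDerivWithinAt)
    (fun z hz => by
      have hz' : 0 ≤ z.re := hz
      simp only [mul_neg, mul_one, norm_neg, Complex.norm_exp, Complex.neg_re]
      exact Real.exp_le_one_iff.2 (by linarith)) (show b ∈ {c : ℂ | 0 ≤ c.re} from hb)
    (show a ∈ {c : ℂ | 0 ≤ c.re} from ha)
  simpa using h

lemma norm_exp_I_mul_sub_one_sub_le_linear (θ : ℝ) :
    ‖Complex.exp (Complex.I * θ) - 1 - Complex.I * θ‖ ≤ 2 * |θ| := by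
  refine (norm_sub_le _ _).trans ?_
  have h := Real.norm_exp_I_mul_ofReal_sub_one_le (x := θ)
  simp only [Real.norm_eq_abs, norm_mul, Complex.norm_I, Complex.norm_real, one_mul] at h ⊢
  linarith

lemma norm_exp_I_mul_sub_one_sub_le_sq (θ : ℝ) :
    ‖Complex.exp (Complex.I * θ) - 1 - Complex.I * θ‖ ≤ 2 * θ ^ 2 := by
  rcases le_total |θ| 1 with h | h
  · have h' := Complex.norm_exp_sub_one_sub_id_le (x := Complex.I * θ) (by simpa using h)
    simp only [norm_mul, Complex.norm_I, Complex.norm_real, one_mul, Real.norm_eq_abs,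
      sq_abs] at h'
    nlinarith [sq_nonneg θ]
  · refine (norm_exp_I_mul_sub_one_sub_le_linear θ).trans ?_
    nlinarith [sq_abs θ]

lemma norm_exp_I_mul_sub_one_le_two (θ : ℝ) : ‖Complex.exp (Complex.I * θ) - 1‖ ≤ 2 := by
  refine (norm_sub_le _ _).trans ?_
  rw [mul_comm, Complex.norm_exp_ofReal_mul_I]
  norm_num

/-- The compensated integrand of the Lévy–Khintchine formula. -/
noncomputable def levyKernel (ξ y : E) : ℂ :=
  Complex.exp (Complex.I * (⟪ξ, y⟫ : ℂ)) - 1 -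
    Complex.I * (if ‖y‖ ≤ 1 then (⟪ξ, y⟫ : ℂ) else 0)

/-- The Lévy–Khintchine exponent of the triplet `(0, γ, ν)`. -/
noncomputable def levyExponent [MeasurableSpace E] (ν : Measure E) (γ ξ : E) : ℂ :=
  -Complex.I * (⟪ξ, γ⟫ : ℂ) - ∫ y, levyKernel ξ y ∂ν

lemma levyKernel_of_le (ξ : E) {y : E} (hy : ‖y‖ ≤ 1) :
    levyKernel ξ y = Complex.exp (Complex.I * (⟪ξ, y⟫ : ℂ)) - 1 - Complex.I * (⟪ξ, y⟫ : ℂ) := by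
  rw [levyKernel, if_pos hy]

lemma levyKernel_of_lt (ξ : E) {y : E} (hy : 1 < ‖y‖) :
    levyKernel ξ y = Complex.exp (Complex.I * (⟪ξ, y⟫ : ℂ)) - 1 := by
  rw [levyKernel, if_neg hy.not_ge, mul_zero, sub_zero]

lemma norm_levyKernel_le (ξ y : E) :
    ‖levyKernel ξ y‖ ≤ 2 * (1 + ‖ξ‖ ^ 2) * min 1 (‖y‖ ^ 2) := by
  rcases le_or_gt ‖y‖ 1 with h | h
  · rw [levyKernel_of_le ξ h, min_eq_right (pow_le_one₀ (norm_nonneg _) h)]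
    refine (norm_exp_I_mul_sub_one_sub_le_sq _).trans ?_
    have h1 : ⟪ξ, y⟫ ^ 2 ≤ (‖ξ‖ * ‖y‖) ^ 2 := by
      rw [← sq_abs ⟪ξ, y⟫]
      exact pow_le_pow_left₀ (abs_nonneg _) (abs_real_inner_le_norm ξ y) 2
    nlinarith [sq_nonneg ‖y‖]
  · rw [levyKernel_of_lt ξ h, min_eq_left (one_le_pow₀ h.le)]
    refine (norm_exp_I_mul_sub_one_le_two _).trans ?_
    nlinarith [sq_nonneg ‖ξ‖]

lemma levyKernel_re (ξ y : E) : (levyKernel ξ y).re = Real.cos ⟪ξ, y⟫ - 1 := by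
  unfold levyKernel
  rw [mul_comm Complex.I]
  split_ifs <;> simp [Complex.exp_ofReal_mul_I_re]

lemma levyKernel_im (ξ y : E) :
    (levyKernel ξ y).im = Real.sin ⟪ξ, y⟫ - (if ‖y‖ ≤ 1 then ⟪ξ, y⟫ else 0) := by
  unfold levyKernel
  rw [mul_comm Complex.I]
  split_ifs <;> simp [Complex.exp_ofReal_mul_I_im]

variable [MeasurableSpace E] [BorelSpace E] [SecondCountableTopology E]

lemma Measurable.levyKernel {α : Type*} [MeasurableSpace α] {f g : α → E} (hf : Measurable f)
    (hg : Measurable g) : Measurable (fun a => levyKernel (f a) (g a)) := by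
  unfold _root_.levyKernel
  have h : Measurable (fun a => ((⟪f a, g a⟫ : ℝ) : ℂ)) := (hf.inner hg).complex_ofReal
  refine ((Complex.measurable_exp.comp (h.const_mul _)).sub_const _).sub (Measurable.const_mul ?_ _)
  exact Measurable.ite (measurableSet_le hg.norm measurable_const) h measurable_const

lemma measurable_levyKernel (ξ : E) : Measurable (levyKernel ξ) :=
  measurable_const.levyKernel measurable_id

variable {ν : Measure E}

lemma integrable_levyKernel (hν : Integrable (fun y => min 1 (‖y‖ ^ 2)) ν) (ξ : E) :
    Integrable (levyKernel ξ) ν :=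
  (hν.const_mul (2 * (1 + ‖ξ‖ ^ 2))).mono' (measurable_levyKernel ξ).aestronglyMeasurable
    (.of_forall (norm_levyKernel_le ξ))

lemma levyExponent_re (hν : Integrable (fun y => min 1 (‖y‖ ^ 2)) ν) (γ ξ : E) :
    (levyExponent ν γ ξ).re = ∫ y, (1 - Real.cos ⟪ξ, y⟫) ∂ν := by
  have h : (∫ y, levyKernel ξ y ∂ν).re = ∫ y, (levyKernel ξ y).re ∂ν :=
    (integral_re (integrable_levyKernel hν ξ)).symm
  rw [levyExponent, Complex.sub_re, h, ← neg_inj, ← integral_neg]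
  simp [levyKernel_re]

lemma levyExponent_re_nonneg (hν : Integrable (fun y => min 1 (‖y‖ ^ 2)) ν) (γ ξ : E) :
    0 ≤ (levyExponent ν γ ξ).re := by
  rw [levyExponent_re hν]
  exact integral_nonneg fun y => sub_nonneg.2 (Real.cos_le_one _)

lemma levyExponent_im (hν : Integrable (fun y => min 1 (‖y‖ ^ 2)) ν) (γ ξ : E) :
    (levyExponent ν γ ξ).im =
      -(⟪ξ, γ⟫ + ∫ y, (Real.sin ⟪ξ, y⟫ - (if ‖y‖ ≤ 1 then ⟪ξ, y⟫ else 0)) ∂ν) := by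
  have h : (∫ y, levyKernel ξ y ∂ν).im = ∫ y, (levyKernel ξ y).im ∂ν :=
    (integral_im (integrable_levyKernel hν ξ)).symm
  rw [levyExponent, Complex.sub_im, h]
  simp only [levyKernel_im]
  simp
  ring

omit [BorelSpace E] [SecondCountableTopology E] in
lemma norm_levyExponent_le (hν : Integrable (fun y => min 1 (‖y‖ ^ 2)) ν) (γ ξ : E) :
    ‖levyExponent ν γ ξ‖ ≤
      (‖γ‖ + 2 * ∫ y, min 1 (‖y‖ ^ 2) ∂ν) * (1 + ‖ξ‖ ^ 2) := by
  have h1 : ‖∫ y, levyKernel ξ y ∂ν‖ ≤ ∫ y, 2 * (1 + ‖ξ‖ ^ 2) * min 1 (‖y‖ ^ 2) ∂ν :=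
    norm_integral_le_of_norm_le (hν.const_mul _) (.of_forall (norm_levyKernel_le ξ))
  rw [integral_const_mul] at h1
  have h2 : ‖-Complex.I * (⟪ξ, γ⟫ : ℂ)‖ ≤ ‖γ‖ * (1 + ‖ξ‖ ^ 2) := by
    rw [norm_mul, norm_neg, Complex.norm_I, one_mul, Complex.norm_real]
    refine (abs_real_inner_le_norm ξ γ).trans ?_
    nlinarith [norm_nonneg γ, sq_nonneg (‖ξ‖ - 1), sq_nonneg ‖ξ‖]
  refine (norm_sub_le _ _).trans ?_
  linarith

omit [InnerProductSpace ℝ E] in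
/-- A measure integrating `min 1 (‖y‖ ^ 2)` without atom at `0` is `σ`-finite. -/
lemma sigmaFinite_of_integrable_min (hν0 : ν {0} = 0)
    (hν : Integrable (fun y => min 1 (‖y‖ ^ 2)) ν) : SigmaFinite ν := by
  set f : E → ℝ≥0∞ := fun y => ENNReal.ofReal (min 1 (‖y‖ ^ 2))
  have hf : Measurable f := by fun_prop
  have hfin : IsFiniteMeasure (ν.withDensity f) := isFiniteMeasure_withDensity_ofReal hν.2
  have hpos : ∀ᵐ y ∂ν, f y ≠ 0 := by
    filter_upwards [measure_eq_zero_iff_ae_notMem.1 hν0] with y hy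
    have : 0 < ‖y‖ := norm_pos_iff.2 hy
    exact (ENNReal.ofReal_pos.2 (by positivity)).ne'
  have hinv := withDensity_inv_same hf hpos (.of_forall fun y => ENNReal.ofReal_ne_top)
  rw [← hinv]
  refine SigmaFinite.withDensity_of_ne_top ?_
  refine (withDensity_absolutelyContinuous ν f).ae_le ?_
  filter_upwards [hpos] with y hy using ENNReal.inv_ne_top.2 hy

end LevyKernel

section WeakConvergence

variable {E : Type*} [NormedAddCommGroup E] [InnerProductSpace ℝ E] [FiniteDimensional ℝ E]
  [MeasurableSpace E] [BorelSpace E]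

/-- Lévy's convergence theorem for finite measures. -/
lemma tendsto_integral_of_tendsto_charFun {μ : ℕ → Measure E} {μ₀ : Measure E}
    [∀ n, IsFiniteMeasure (μ n)] [IsFiniteMeasure μ₀]
    (h : ∀ ξ, Tendsto (fun n => charFun (μ n) ξ) atTop (𝓝 (charFun μ₀ ξ)))
    (k : BoundedContinuousFunction E ℝ) :
    Tendsto (fun n => ∫ x, k x ∂(μ n)) atTop (𝓝 (∫ x, k x ∂μ₀)) := by
  -- adding a unit mass at `0` allows one to normalise
  let Q : (m : Measure E) → Measure E := fun m =>
    (1 + m Set.univ)⁻¹ • (Measure.dirac 0 + m)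
  have hne : ∀ m : Measure E, 1 + m Set.univ ≠ 0 := fun m => by simp
  have hnt : ∀ (m : Measure E) [IsFiniteMeasure m], 1 + m Set.univ ≠ ⊤ := fun m _ => by simp
  have hQ : ∀ (m : Measure E) [IsFiniteMeasure m], IsProbabilityMeasure (Q m) := fun m _ => by
    refine ⟨?_⟩
    simp only [Q, Measure.smul_apply, Measure.add_apply, smul_eq_mul, measure_univ]
    exact ENNReal.inv_mul_cancel (hne m) (hnt m)
  have hQI : ∀ (m : Measure E) [IsFiniteMeasure m] (f : BoundedContinuousFunction E ℝ),
      ∫ x, f x ∂(Q m) = (1 + m.real Set.univ)⁻¹ * (f 0 + ∫ x, f x ∂m) := fun m _ f => by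
    simp only [Q]
    rw [integral_smul_measure, integral_add_measure (f.integrable _) (f.integrable _),
      integral_dirac, ENNReal.toReal_inv, ENNReal.toReal_add (by simp) (by simp)]
    simp [Measure.real]
  have hQC : ∀ (m : Measure E) [IsFiniteMeasure m] (ξ : E),
      charFun (Q m) ξ = (1 + (m.real Set.univ : ℂ))⁻¹ * (1 + charFun m ξ) := fun m _ ξ => by
    have hi : ∀ (m : Measure E) [IsFiniteMeasure m],
        Integrable (fun x => Complex.exp (⟪x, ξ⟫ * Complex.I)) m := fun m _ =>
      Integrable.of_bound (by fun_prop) 1 (.of_forall fun x => by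
        rw [Complex.norm_exp_ofReal_mul_I])
    simp only [Q, charFun_apply]
    rw [integral_smul_measure, integral_add_measure (hi _) (hi _),
      integral_dirac, ENNReal.toReal_inv, ENNReal.toReal_add (by simp) (by simp)]
    simp [Measure.real, mul_add]
  have hmass : Tendsto (fun n => (μ n).real Set.univ) atTop (𝓝 (μ₀.real Set.univ)) := by
    have h0 := (Complex.continuous_re.tendsto _).comp (h 0)
    simpa [Function.comp_def] using h0
  have hpos : ∀ m : Measure E, 1 + m.real Set.univ ≠ 0 := fun m => by positivity
  let P : ℕ → ProbabilityMeasure E := fun n => ⟨Q (μ n), hQ _⟩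
  let P₀ : ProbabilityMeasure E := ⟨Q μ₀, hQ _⟩
  have hP : Tendsto P atTop (𝓝 P₀) := by
    rw [ProbabilityMeasure.tendsto_iff_tendsto_charFun]
    intro ξ
    change Tendsto (fun n => charFun (Q (μ n)) ξ) atTop (𝓝 (charFun (Q μ₀) ξ))
    simp only [hQC]
    refine Tendsto.mul (Tendsto.inv₀ ?_ ?_) ((h ξ).const_add 1)
    · exact ((Complex.continuous_ofReal.tendsto _).comp hmass).const_add 1
    · exact_mod_cast hpos μ₀
  have hk := ProbabilityMeasure.tendsto_iff_forall_integral_tendsto.1 hP k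
  change Tendsto (fun n => ∫ x, k x ∂(Q (μ n))) atTop (𝓝 (∫ x, k x ∂(Q μ₀))) at hk
  simp only [hQI] at hk
  have h2 := ((hmass.const_add 1).mul hk).sub_const (k 0)
  have heq : ∀ (m : Measure E),
      (1 + m.real Set.univ) * ((1 + m.real Set.univ)⁻¹ * (k 0 + ∫ x, k x ∂m)) - k 0
        = ∫ x, k x ∂m := fun m => by
    rw [mul_inv_cancel_left₀ (hpos m)]; ring
  simpa only [heq] using h2

end WeakConvergence

section GaussianWeight

open ProbabilityTheory

variable {E : Type*} [NormedAddCommGroup E] [InnerProductSpace ℝ E] [FiniteDimensional ℝ E]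
  [MeasurableSpace E] [BorelSpace E]

/-- The weight `1 - exp (-‖x‖² / 2)`, that is, one minus the characteristic function of the
standard Gaussian law. -/
noncomputable def gaussianWeight (x : E) : ℝ := 1 - Real.exp (-(‖x‖ ^ 2 / 2))

omit [InnerProductSpace ℝ E] [FiniteDimensional ℝ E] [MeasurableSpace E] [BorelSpace E] in
lemma continuous_gaussianWeight : Continuous (gaussianWeight (E := E)) := by
  unfold gaussianWeight; fun_prop

omit [InnerProductSpace ℝ E] [FiniteDimensional ℝ E] [MeasurableSpace E] [BorelSpace E] in
lemma gaussianWeight_nonneg (x : E) : 0 ≤ gaussianWeight x :=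
  sub_nonneg.2 (Real.exp_le_one_iff.2 (by have := sq_nonneg ‖x‖; linarith))

omit [InnerProductSpace ℝ E] [FiniteDimensional ℝ E] [MeasurableSpace E] [BorelSpace E] in
lemma gaussianWeight_le_min (x : E) : gaussianWeight x ≤ min 1 (‖x‖ ^ 2) := by
  unfold gaussianWeight
  refine le_min (by linarith [Real.exp_pos (-(‖x‖ ^ 2 / 2))]) ?_
  linarith [Real.add_one_le_exp (-(‖x‖ ^ 2 / 2)), sq_nonneg ‖x‖]

omit [InnerProductSpace ℝ E] [FiniteDimensional ℝ E] [MeasurableSpace E] [BorelSpace E] in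
lemma norm_gaussianWeight_le_one (x : E) : ‖gaussianWeight x‖ ≤ 1 := by
  rw [Real.norm_of_nonneg (gaussianWeight_nonneg x)]
  exact (gaussianWeight_le_min x).trans (min_le_left _ _)

omit [InnerProductSpace ℝ E] [FiniteDimensional ℝ E] [MeasurableSpace E] [BorelSpace E] in
lemma le_gaussianWeight {δ : ℝ} (hδ : 0 ≤ δ) {x : E} (hx : δ ≤ ‖x‖) :
    1 - Real.exp (-(δ ^ 2 / 2)) ≤ gaussianWeight x := by
  unfold gaussianWeight
  have := pow_le_pow_left₀ hδ hx 2
  gcongr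

lemma integral_exp_stdGaussian (x : E) :
    ∫ u, Complex.exp (Complex.I * (⟪u, x⟫ : ℂ)) ∂(stdGaussian E) =
      ((1 - gaussianWeight x : ℝ) : ℂ) := by
  have h := charFun_stdGaussian (E := E) x
  rw [charFun_apply] at h
  simp only [mul_comm Complex.I]
  rw [h, gaussianWeight]
  push_cast
  ring_nf

lemma integrable_norm_sq_stdGaussian : Integrable (fun u : E => ‖u‖ ^ 2) (stdGaussian E) := by
  have h := IsGaussian.memLp_two_id (μ := stdGaussian E)
  exact h.integrable_norm_pow (by norm_num)

lemma integral_inner_stdGaussian (x : E) : ∫ u, ⟪u, x⟫ ∂(stdGaussian E) = 0 := by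
  have h := integral_strongDual_stdGaussian (E := E) (innerSL ℝ x)
  simpa [real_inner_comm] using h

/-- The weighted characteristic function in terms of the characteristic function. -/
lemma integral_exp_mul_gaussianWeight (P : Measure E) [IsProbabilityMeasure P] (ξ : E) :
    ∫ x, Complex.exp (Complex.I * (⟪ξ, x⟫ : ℂ)) * (gaussianWeight x : ℂ) ∂P =
      ∫ u, ((∫ x, Complex.exp (Complex.I * (⟪ξ, x⟫ : ℂ)) ∂P) -
        ∫ x, Complex.exp (Complex.I * (⟪ξ + u, x⟫ : ℂ)) ∂P) ∂(stdGaussian E) := by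
  have hn : ∀ θ : ℝ, ‖Complex.exp (Complex.I * θ)‖ = 1 := fun θ => by
    rw [mul_comm, Complex.norm_exp_ofReal_mul_I]
  have hi : ∀ ξ : E, Integrable (fun x => Complex.exp (Complex.I * (⟪ξ, x⟫ : ℂ))) P := fun ξ =>
    Integrable.of_bound (by fun_prop) 1 (.of_forall fun x => (hn _).le)
  have hint : Integrable (Function.uncurry fun u x : E =>
      Complex.exp (Complex.I * (⟪ξ, x⟫ : ℂ)) - Complex.exp (Complex.I * (⟪ξ + u, x⟫ : ℂ)))
      ((stdGaussian E).prod P) := by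
    refine Integrable.of_bound ?_ 2 (.of_forall fun q => ?_)
    · exact Continuous.aestronglyMeasurable (by unfold Function.uncurry; fun_prop)
    · refine (norm_sub_le _ _).trans ?_
      rw [hn, hn]; norm_num
  simp_rw [← integral_sub (hi _) (hi _)]
  rw [integral_integral_swap hint]
  refine integral_congr_ae (.of_forall fun x => ?_)
  have hadd : ∀ u : E, Complex.exp (Complex.I * (⟪ξ, x⟫ : ℂ)) -
      Complex.exp (Complex.I * (⟪ξ + u, x⟫ : ℂ)) = Complex.exp (Complex.I * (⟪ξ, x⟫ : ℂ)) *
        (1 - Complex.exp (Complex.I * (⟪u, x⟫ : ℂ))) := fun u => by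
    rw [inner_add_left, Complex.ofReal_add, mul_add, Complex.exp_add]; ring
  have hg : Integrable (fun u : E => Complex.exp (Complex.I * (⟪u, x⟫ : ℂ))) (stdGaussian E) :=
    Integrable.of_bound (by fun_prop) 1 (.of_forall fun x => (hn _).le)
  simp_rw [hadd]
  rw [integral_const_mul, integral_sub (integrable_const _) hg, integral_exp_stdGaussian]
  simp

/-- The weighted Lévy measure in terms of the characteristic exponent. -/
lemma integral_exp_mul_gaussianWeight_levy {ν : Measure E} [SFinite ν]
    (hν : Integrable (fun y => min 1 (‖y‖ ^ 2)) ν) (γ ξ : E) :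
    ∫ y, Complex.exp (Complex.I * (⟪ξ, y⟫ : ℂ)) * (gaussianWeight y : ℂ) ∂ν =
      ∫ u, (levyExponent ν γ (ξ + u) - levyExponent ν γ ξ) ∂(stdGaussian E) := by
  have hn : ∀ θ : ℝ, ‖Complex.exp (Complex.I * θ)‖ = 1 := fun θ => by
    rw [mul_comm, Complex.norm_exp_ofReal_mul_I]
  have hexp : ∀ u, levyExponent ν γ (ξ + u) - levyExponent ν γ ξ =
      -Complex.I * (⟪u, γ⟫ : ℂ) - ∫ y, (levyKernel (ξ + u) y - levyKernel ξ y) ∂ν := fun u => by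
    rw [integral_sub (integrable_levyKernel hν _) (integrable_levyKernel hν _)]
    simp only [levyExponent, inner_add_left, Complex.ofReal_add]
    ring
  have hint : Integrable (Function.uncurry fun u y : E => levyKernel (ξ + u) y - levyKernel ξ y)
      ((stdGaussian E).prod ν) := by
    have hb : Integrable (fun u : E => 4 * (1 + ‖ξ‖ ^ 2 + ‖u‖ ^ 2)) (stdGaussian E) :=
      ((integrable_const _).add integrable_norm_sq_stdGaussian).const_mul 4
    refine ((hb.mul_prod hν).const_mul 2).mono' ?_ (.of_forall fun q => ?_)
    · have h1 : Measurable (fun q : E × E => levyKernel (ξ + q.1) q.2) :=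
        (measurable_fst.const_add ξ).levyKernel measurable_snd
      have h2 : Measurable (fun q : E × E => levyKernel ξ q.2) :=
        measurable_const.levyKernel measurable_snd
      exact (h1.sub h2).aestronglyMeasurable
    · simp only [Function.uncurry]
      refine (norm_sub_le _ _).trans ((add_le_add (norm_levyKernel_le _ _)
        (norm_levyKernel_le _ _)).trans ?_)
      have h3 : ‖ξ + q.1‖ ^ 2 ≤ 2 * ‖ξ‖ ^ 2 + 2 * ‖q.1‖ ^ 2 := by
        have := pow_le_pow_left₀ (norm_nonneg _) (norm_add_le ξ q.1) 2
        nlinarith [sq_nonneg (‖ξ‖ - ‖q.1‖)]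
      have h4 : 0 ≤ min 1 (‖q.2‖ ^ 2) := by positivity
      rw [← add_mul, ← mul_assoc]
      refine mul_le_mul_of_nonneg_right ?_ h4
      nlinarith [sq_nonneg ‖ξ‖, sq_nonneg ‖q.1‖]
  have hinner : ∀ x : E, Integrable (fun u : E => ((⟪u, x⟫ : ℝ) : ℂ)) (stdGaussian E) := fun x => by
    have h := (IsGaussian.integrable_id (μ := stdGaussian E)).inner_const (𝕜 := ℝ) x
    exact h.ofReal
  have hinner0 : ∀ x : E, ∫ u, ((⟪u, x⟫ : ℝ) : ℂ) ∂(stdGaussian E) = 0 := fun x => by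
    rw [integral_complex_ofReal, integral_inner_stdGaussian, Complex.ofReal_zero]
  have hip : Integrable (fun u => ∫ y, (levyKernel (ξ + u) y - levyKernel ξ y) ∂ν)
      (stdGaussian E) := hint.integral_prod_left
  simp_rw [hexp]
  rw [integral_sub ((hinner γ).const_mul _) hip, integral_const_mul, hinner0,
    mul_zero, zero_sub, integral_integral_swap hint, ← integral_neg]
  refine integral_congr_ae (.of_forall fun y => ?_)
  have hk : ∀ u, levyKernel (ξ + u) y - levyKernel ξ y = Complex.exp (Complex.I * (⟪ξ, y⟫ : ℂ)) *
      (Complex.exp (Complex.I * (⟪u, y⟫ : ℂ)) - 1) -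
        (Complex.I * if ‖y‖ ≤ 1 then 1 else 0) * (⟪u, y⟫ : ℂ) := fun u => by
    simp only [levyKernel]
    rw [inner_add_left, Complex.ofReal_add, mul_add, Complex.exp_add]
    split_ifs <;> ring
  have hg : Integrable (fun u : E => Complex.exp (Complex.I * (⟪u, y⟫ : ℂ)) - 1) (stdGaussian E) :=
    Integrable.of_bound (by fun_prop) 2 (.of_forall fun u => norm_exp_I_mul_sub_one_le_two _)
  have hg' : Integrable (fun u : E => Complex.exp (Complex.I * (⟪u, y⟫ : ℂ))) (stdGaussian E) :=
    Integrable.of_bound (by fun_prop) 1 (.of_forall fun x => (hn _).le)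
  simp_rw [hk]
  rw [integral_sub (hg.const_mul _) ((hinner y).const_mul _), integral_const_mul,
    integral_const_mul, hinner0, integral_sub hg' (integrable_const _), integral_exp_stdGaussian]
  simp

end GaussianWeight

section SmallTime

open ProbabilityTheory

variable {E : Type*} [NormedAddCommGroup E] [InnerProductSpace ℝ E] [FiniteDimensional ℝ E]
  [MeasurableSpace E] [BorelSpace E]

lemma tendsto_inv_mul_exp_neg_mul_sub_one {t : ℕ → ℝ} (ht0 : ∀ n, 0 < t n)
    (ht : Tendsto t atTop (𝓝 0)) (a : ℂ) :
    Tendsto (fun n => ((t n : ℂ))⁻¹ * (Complex.exp (-(t n : ℂ) * a) - 1)) atTop (𝓝 (-a)) := by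
  have h1 : HasDerivAt (fun s : ℝ => Complex.exp (-(s : ℂ) * a)) (-a) 0 := by
    have h : HasDerivAt (fun s : ℝ => -(s : ℂ) * a) (-1 * a) 0 :=
      ((hasDerivAt_id (0 : ℝ)).ofReal_comp.neg).mul_const a
    simpa using h.cexp
  have h2 := h1.tendsto_slope_zero.comp (tendsto_nhdsWithin_iff.2
    ⟨ht, .of_forall fun n => (ht0 n).ne'⟩)
  simpa [Function.comp_def] using h2

omit [InnerProductSpace ℝ E] [FiniteDimensional ℝ E] in
lemma integral_withDensity_gaussianWeight {F : Type*} [NormedAddCommGroup F] [NormedSpace ℝ F]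
    (ρ : Measure E) (g : E → F) :
    ∫ x, g x ∂(ρ.withDensity fun x => ENNReal.ofReal (gaussianWeight x)) =
      ∫ x, gaussianWeight x • g x ∂ρ := by
  rw [integral_withDensity_eq_integral_toReal_smul
    continuous_gaussianWeight.measurable.ennreal_ofReal (.of_forall fun x => ENNReal.ofReal_lt_top)]
  simp only [ENNReal.toReal_ofReal (gaussianWeight_nonneg _)]

variable {ν : Measure E} [SFinite ν] {γ : E} {t : ℕ → ℝ} {P : ℕ → Measure E}
  [∀ n, IsProbabilityMeasure (P n)]

/-- Convergence of the Gaussian-weighted characteristic functions of an infinitely divisible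
family for small times. -/
lemma tendsto_inv_mul_integral_exp_mul_gaussianWeight
    (hν : Integrable (fun y => min 1 (‖y‖ ^ 2)) ν) (ht0 : ∀ n, 0 < t n)
    (ht : Tendsto t atTop (𝓝 0))
    (hP : ∀ n ξ, ∫ x, Complex.exp (Complex.I * (⟪ξ, x⟫ : ℂ)) ∂(P n) =
      Complex.exp (-(t n : ℂ) * levyExponent ν γ ξ)) (ξ : E) :
    Tendsto (fun n => ((t n : ℂ))⁻¹ *
        ∫ x, Complex.exp (Complex.I * (⟪ξ, x⟫ : ℂ)) * (gaussianWeight x : ℂ) ∂(P n)) atTop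
      (𝓝 (∫ y, Complex.exp (Complex.I * (⟪ξ, y⟫ : ℂ)) * (gaussianWeight y : ℂ) ∂ν)) := by
  rw [integral_exp_mul_gaussianWeight_levy hν γ ξ]
  simp_rw [integral_exp_mul_gaussianWeight, ← integral_const_mul]
  set K := ‖γ‖ + 2 * ∫ y, min 1 (‖y‖ ^ 2) ∂ν with hK
  have hK0 : 0 ≤ K := by
    have : 0 ≤ ∫ y, min 1 (‖y‖ ^ 2) ∂ν := integral_nonneg fun y => by positivity
    positivity
  refine tendsto_integral_of_dominated_convergence
    (fun u : E => K * (1 + ‖ξ‖ ^ 2) + K * (1 + 2 * ‖ξ‖ ^ 2 + 2 * ‖u‖ ^ 2)) (fun n => ?_) ?_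
    (fun n => .of_forall fun u => ?_) (.of_forall fun u => ?_)
  · have hm : StronglyMeasurable
        (fun u : E => ∫ x, Complex.exp (Complex.I * (⟪ξ + u, x⟫ : ℂ)) ∂(P n)) :=
      StronglyMeasurable.integral_prod_right
        (f := fun u x : E => Complex.exp (Complex.I * (⟪ξ + u, x⟫ : ℂ)))
        (Continuous.stronglyMeasurable (by unfold Function.uncurry; fun_prop))
    exact ((stronglyMeasurable_const.sub hm).const_mul _).aestronglyMeasurable
  · exact (integrable_const _).add (((integrable_const _).add
      (integrable_norm_sq_stdGaussian.const_mul 2)).const_mul K)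
  · have hre : ∀ ζ : E, 0 ≤ ((t n : ℂ) * levyExponent ν γ ζ).re := fun ζ => by
      rw [Complex.re_ofReal_mul]
      exact mul_nonneg (ht0 n).le (levyExponent_re_nonneg hν γ ζ)
    rw [hP, hP, norm_mul, norm_inv, Complex.norm_real, Real.norm_of_nonneg (ht0 n).le]
    rw [inv_mul_le_iff₀ (ht0 n)]
    simp only [neg_mul]
    refine (Complex.norm_exp_neg_sub_exp_neg_le (hre _) (hre _)).trans ?_
    rw [← mul_sub, norm_mul, Complex.norm_real, Real.norm_of_nonneg (ht0 n).le]
    refine mul_le_mul_of_nonneg_left ?_ (ht0 n).le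
    refine (norm_sub_le _ _).trans (add_le_add (norm_levyExponent_le hν γ _)
      ((norm_levyExponent_le hν γ _).trans (mul_le_mul_of_nonneg_left ?_ hK0)))
    have := pow_le_pow_left₀ (norm_nonneg _) (norm_add_le ξ u) 2
    nlinarith [sq_nonneg (‖ξ‖ - ‖u‖)]
  · simp_rw [hP]
    have h := (tendsto_inv_mul_exp_neg_mul_sub_one ht0 ht (levyExponent ν γ ξ)).sub
      (tendsto_inv_mul_exp_neg_mul_sub_one ht0 ht (levyExponent ν γ (ξ + u)))
    convert h using 2 <;> ring

/-- Vague convergence of `t⁻¹ p_t` to the Lévy measure away from the origin. -/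
lemma tendsto_inv_mul_integral_of_eq_zero_near_zero
    (hν : Integrable (fun y => min 1 (‖y‖ ^ 2)) ν) (ht0 : ∀ n, 0 < t n)
    (ht : Tendsto t atTop (𝓝 0))
    (hP : ∀ n ξ, ∫ x, Complex.exp (Complex.I * (⟪ξ, x⟫ : ℂ)) ∂(P n) =
      Complex.exp (-(t n : ℂ) * levyExponent ν γ ξ))
    {f : E → ℝ} (hf : Continuous f) {M : ℝ} (hM : ∀ x, |f x| ≤ M) {δ : ℝ} (hδ : 0 < δ)
    (hf0 : ∀ x, ‖x‖ < δ → f x = 0) :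
    Tendsto (fun n => (t n)⁻¹ * ∫ x, f x ∂(P n)) atTop (𝓝 (∫ x, f x ∂ν)) := by
  have hwm : Measurable (gaussianWeight (E := E)) := continuous_gaussianWeight.measurable
  have hwν : Integrable (gaussianWeight (E := E)) ν :=
    hν.mono' hwm.aestronglyMeasurable (.of_forall fun x => by
      rw [Real.norm_of_nonneg (gaussianWeight_nonneg x)]; exact gaussianWeight_le_min x)
  let w : E → ℝ≥0∞ := fun x => ENNReal.ofReal (gaussianWeight x)
  have hw : Measurable w := hwm.ennreal_ofReal
  have hwP : ∀ n, Integrable (gaussianWeight (E := E)) (P n) := fun n =>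
    Integrable.of_bound hwm.aestronglyMeasurable 1 (.of_forall norm_gaussianWeight_le_one)
  have hfin : ∀ n, IsFiniteMeasure ((P n).withDensity w) := fun n =>
    isFiniteMeasure_withDensity_ofReal (hwP n).2
  have hfinν : IsFiniteMeasure (ν.withDensity w) := isFiniteMeasure_withDensity_ofReal hwν.2
  let m : ℕ → Measure E := fun n => ENNReal.ofReal (t n)⁻¹ • (P n).withDensity w
  have hfinm : ∀ n, IsFiniteMeasure (m n) := fun n =>
    Measure.smul_finite _ ENNReal.ofReal_ne_top
  have hchar : ∀ ξ, Tendsto (fun n => charFun (m n) ξ) atTop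
      (𝓝 (charFun (ν.withDensity w) ξ)) := fun ξ => by
    have h := tendsto_inv_mul_integral_exp_mul_gaussianWeight hν ht0 ht hP ξ
    simp only [charFun_apply, m, integral_smul_measure, w, integral_withDensity_gaussianWeight,
      ENNReal.toReal_ofReal (inv_nonneg.2 (ht0 _).le)]
    simpa only [Complex.real_smul, Complex.ofReal_inv, mul_comm Complex.I, real_inner_comm,
      mul_comm (Complex.exp _)] using h
  set c := 1 - Real.exp (-(δ ^ 2 / 2)) with hc
  have hcpos : 0 < c := by
    have : Real.exp (-(δ ^ 2 / 2)) < 1 := Real.exp_lt_one_iff.2 (by have := pow_pos hδ 2; linarith)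
    linarith
  -- dividing by the weight bounded from below does not change the quotient where `f ≠ 0`
  have hmul : ∀ x, gaussianWeight x * (f x / max c (gaussianWeight x)) = f x := fun x => by
    rcases lt_or_ge ‖x‖ δ with h | h
    · simp [hf0 x h]
    · have h1 := le_gaussianWeight hδ.le h
      rw [max_eq_right h1, mul_div_cancel₀]
      exact (hcpos.trans_le h1).ne'
  have hM0 : 0 ≤ M := (abs_nonneg _).trans (hM 0)
  let k : BoundedContinuousFunction E ℝ := BoundedContinuousFunction.ofNormedAddCommGroup
    (fun x => f x / max c (gaussianWeight x))
    (hf.div (continuous_const.max continuous_gaussianWeight)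
      fun x => (lt_max_of_lt_left hcpos).ne') (M / c) (fun x => by
        have h0 : 0 < max c (gaussianWeight x) := lt_max_of_lt_left hcpos
        rw [norm_div, Real.norm_of_nonneg h0.le]
        exact div_le_div₀ hM0 (hM x) hcpos (le_max_left _ _))
  have hk := tendsto_integral_of_tendsto_charFun hchar k
  simp only [m, integral_smul_measure, w, integral_withDensity_gaussianWeight, ENNReal.toReal_ofReal (inv_nonneg.2 (ht0 _).le)] at hk
  have hkx : ∀ x, gaussianWeight x • k x = f x := hmul
  simpa only [hkx, smul_eq_mul] using hk

end SmallTime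

section FractionalMoments

lemma setLIntegral_Ioi_rpow {a c : ℝ} (ha : a < -1) (hc : 0 < c) :
    ∫⁻ u in Set.Ioi c, ENNReal.ofReal (u ^ a) = ENNReal.ofReal (-c ^ (a + 1) / (a + 1)) := by
  rw [← integral_Ioi_rpow_of_lt ha hc, ofReal_integral_eq_lintegral_ofReal
    (integrableOn_Ioi_rpow_of_lt ha hc)]
  filter_upwards [ae_restrict_mem measurableSet_Ioi] with u hu
  exact Real.rpow_nonneg (hc.trans hu).le _

lemma setLIntegral_Ioc_zero_rpow {a c : ℝ} (ha : -1 < a) (hc : 0 < c) :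
    ∫⁻ u in Set.Ioc 0 c, ENNReal.ofReal (u ^ a) = ENNReal.ofReal (c ^ (a + 1) / (a + 1)) := by
  have h := integral_rpow (a := 0) (b := c) (r := a) (.inl ha)
  rw [Real.zero_rpow (by linarith), sub_zero, intervalIntegral.integral_of_le hc.le] at h
  rw [← h, ofReal_integral_eq_lintegral_ofReal]
  · exact (intervalIntegral.intervalIntegrable_rpow' ha).1
  · filter_upwards [ae_restrict_mem measurableSet_Ioc] with u hu
    exact Real.rpow_nonneg hu.1.le _

/-- Scaling bound for `∫ u ^ (-1 - β) min ((u s) ^ a) ((u s) ^ b) du` when `a < β < b`. -/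
lemma lintegral_rpow_mul_min_le {a b β s : ℝ} (ha : a < β) (hb : β < b) (hs : 0 < s) :
    ∫⁻ u in Set.Ioi (0 : ℝ), ENNReal.ofReal (u ^ (-1 - β) * min ((u * s) ^ a) ((u * s) ^ b)) ≤
      ENNReal.ofReal (s ^ β * (1 / (β - a) + 1 / (b - β))) := by
  have hs' : 0 < s⁻¹ := inv_pos.2 hs
  have key : ∀ (c u : ℝ), 0 < u → u ^ (-1 - β) * (u * s) ^ c = s ^ c * u ^ (c - β - 1) :=
    fun c u hu => by
      rw [Real.mul_rpow hu.le hs.le, mul_comm, mul_comm (u ^ c), mul_assoc, ← Real.rpow_add hu]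
      ring_nf
  have hsc : ∀ c : ℝ, s ^ c * (s⁻¹) ^ (c - β) = s ^ β := fun c => by
    rw [Real.inv_rpow hs.le, ← Real.rpow_neg hs.le, ← Real.rpow_add hs]
    ring_nf
  rw [← Set.Ioc_union_Ioi_eq_Ioi hs'.le, lintegral_union measurableSet_Ioi
    (Set.Ioc_disjoint_Ioi le_rfl), mul_add, add_comm (s ^ β * _),
    ENNReal.ofReal_add (mul_nonneg (by positivity) (one_div_nonneg.2 (by linarith)))
      (mul_nonneg (by positivity) (one_div_nonneg.2 (by linarith)))]
  refine add_le_add ?_ ?_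
  · calc ∫⁻ u in Set.Ioc 0 s⁻¹,
          ENNReal.ofReal (u ^ (-1 - β) * min ((u * s) ^ a) ((u * s) ^ b))
        ≤ ∫⁻ u in Set.Ioc 0 s⁻¹, ENNReal.ofReal (s ^ b) * ENNReal.ofReal (u ^ (b - β - 1)) := by
          refine setLIntegral_mono' measurableSet_Ioc fun u hu => ?_
          rw [← ENNReal.ofReal_mul (by positivity), ← key b u hu.1]
          exact ENNReal.ofReal_le_ofReal
            (mul_le_mul_of_nonneg_left (min_le_right _ _) (Real.rpow_nonneg hu.1.le _))
      _ = ENNReal.ofReal (s ^ β * (1 / (b - β))) := by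
          rw [lintegral_const_mul _ (by fun_prop), setLIntegral_Ioc_zero_rpow (by linarith) hs',
            ← ENNReal.ofReal_mul (by positivity), sub_add_cancel, ← mul_div_assoc, hsc,
            mul_one_div]
  · calc ∫⁻ u in Set.Ioi s⁻¹,
          ENNReal.ofReal (u ^ (-1 - β) * min ((u * s) ^ a) ((u * s) ^ b))
        ≤ ∫⁻ u in Set.Ioi s⁻¹, ENNReal.ofReal (s ^ a) * ENNReal.ofReal (u ^ (a - β - 1)) := by
          refine setLIntegral_mono' measurableSet_Ioi fun u hu => ?_
          have hu0 : 0 < u := hs'.trans hu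
          rw [← ENNReal.ofReal_mul (by positivity), ← key a u hu0]
          exact ENNReal.ofReal_le_ofReal
            (mul_le_mul_of_nonneg_left (min_le_left _ _) (Real.rpow_nonneg hu0.le _))
      _ = ENNReal.ofReal (s ^ β * (1 / (β - a))) := by
          rw [lintegral_const_mul _ (by fun_prop), setLIntegral_Ioi_rpow (by linarith) hs',
            ← ENNReal.ofReal_mul (by positivity), sub_add_cancel, neg_div, ← div_neg, neg_sub,
            ← mul_div_assoc, hsc, mul_one_div]

lemma ofReal_rpow_div_le_setLIntegral_one_sub_cos {β R z : ℝ} (hβ0 : 0 < β) (hβ2 : β ≤ 2)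
    (hR : 0 < R) (hz : |z| ≤ R⁻¹) :
    ENNReal.ofReal (|z| ^ β / 32) ≤
      ∫⁻ u in Set.Ioi R, ENNReal.ofReal (u ^ (-1 - β) * (1 - Real.cos (u * z))) := by
  rcases eq_or_ne z 0 with rfl | hz0
  · simp [Real.zero_rpow hβ0.ne']
  have hzp : 0 < |z| := abs_pos.2 hz0
  set a := |z|⁻¹ with ha
  have ha0 : 0 < a := inv_pos.2 hzp
  have hRa : R ≤ a := by rw [ha]; exact (le_inv_comm₀ hzp hR).1 hz
  have hconst : ∀ u ∈ Set.Ioc a (2 * a), (2 * a) ^ (-1 - β) * (1 / 4) ≤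
      u ^ (-1 - β) * (1 - Real.cos (u * z)) := fun u hu => by
    have hu0 : 0 < u := ha0.trans hu.1
    have h1 : (2 * a) ^ (-1 - β) ≤ u ^ (-1 - β) :=
      Real.rpow_le_rpow_of_nonpos hu0 hu.2 (by linarith)
    have h2 : Real.cos (u * z) ≤ 5 / 9 := by
      rw [← Real.cos_abs, abs_mul, abs_of_pos hu0]
      have h3 : 1 ≤ u * |z| := by
        have := mul_le_mul_of_nonneg_right hu.1.le hzp.le
        rwa [ha, inv_mul_cancel₀ hzp.ne'] at this
      have h4 : u * |z| ≤ 2 := by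
        have := mul_le_mul_of_nonneg_right hu.2 hzp.le
        rwa [ha, mul_assoc, inv_mul_cancel₀ hzp.ne', mul_one] at this
      refine (Real.cos_le_cos_of_nonneg_of_le_pi zero_le_one ?_ h3).trans Real.cos_one_le
      linarith [Real.pi_gt_three]
    exact mul_le_mul h1 (by linarith) (by norm_num) (Real.rpow_nonneg hu0.le _)
  calc ENNReal.ofReal (|z| ^ β / 32)
      ≤ ENNReal.ofReal ((2 * a) ^ (-1 - β) * (1 / 4)) * ENNReal.ofReal (2 * a - a) := by
        rw [← ENNReal.ofReal_mul (by positivity)]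
        refine ENNReal.ofReal_le_ofReal ?_
        have h1 : a ^ (-1 - β) * a = |z| ^ β := by
          rw [← Real.rpow_add_one ha0.ne', ha, Real.inv_rpow hzp.le, ← Real.rpow_neg hzp.le]
          ring_nf
        have h2 : (1 / 8 : ℝ) ≤ 2 ^ (-1 - β) := by
          have h3 : (2 : ℝ) ^ (-3 : ℝ) ≤ 2 ^ (-1 - β) :=
            Real.rpow_le_rpow_of_exponent_le (by norm_num) (by linarith)
          have h4 : (2 : ℝ) ^ (-3 : ℝ) = 1 / 8 := by
            rw [Real.rpow_neg (by norm_num)]; norm_num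
          rwa [h4] at h3
        have h5 : (2 * a) ^ (-1 - β) * (1 / 4) * (2 * a - a) =
            2 ^ (-1 - β) * (1 / 4) * |z| ^ β := by
          rw [Real.mul_rpow (by norm_num) ha0.le, ← h1]; ring
        rw [h5]
        have h6 : 0 ≤ |z| ^ β := by positivity
        nlinarith
    _ = ∫⁻ u in Set.Ioc a (2 * a), ENNReal.ofReal ((2 * a) ^ (-1 - β) * (1 / 4)) := by
        rw [setLIntegral_const, Real.volume_Ioc]
    _ ≤ ∫⁻ u in Set.Ioc a (2 * a), ENNReal.ofReal (u ^ (-1 - β) * (1 - Real.cos (u * z))) :=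
        setLIntegral_mono' measurableSet_Ioc fun u hu => ENNReal.ofReal_le_ofReal (hconst u hu)
    _ ≤ _ := lintegral_mono_set fun u hu => hRa.trans_lt hu.1

variable {E : Type*} [NormedAddCommGroup E] [InnerProductSpace ℝ E]
  [MeasurableSpace E] [BorelSpace E] [SecondCountableTopology E]

lemma re_integral_exp_I_mul_inner (P : Measure E) [IsProbabilityMeasure P] (ξ : E) :
    (∫ x, Complex.exp (Complex.I * (⟪ξ, x⟫ : ℂ)) ∂P).re = ∫ x, Real.cos ⟪ξ, x⟫ ∂P := by
  have hi : Integrable (fun x => Complex.exp (Complex.I * (⟪ξ, x⟫ : ℂ))) P :=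
    Integrable.of_bound (by fun_prop) 1 (.of_forall fun x => by
      rw [mul_comm, Complex.norm_exp_ofReal_mul_I])
  refine (integral_re hi).symm.trans (integral_congr_ae (.of_forall fun x => ?_))
  simp [mul_comm Complex.I, Complex.exp_ofReal_mul_I_re]

lemma im_integral_exp_I_mul_inner (P : Measure E) [IsProbabilityMeasure P] (ξ : E) :
    (∫ x, Complex.exp (Complex.I * (⟪ξ, x⟫ : ℂ)) ∂P).im = ∫ x, Real.sin ⟪ξ, x⟫ ∂P := by
  have hi : Integrable (fun x => Complex.exp (Complex.I * (⟪ξ, x⟫ : ℂ))) P :=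
    Integrable.of_bound (by fun_prop) 1 (.of_forall fun x => by
      rw [mul_comm, Complex.norm_exp_ofReal_mul_I])
  refine (integral_im hi).symm.trans (integral_congr_ae (.of_forall fun x => ?_))
  simp [mul_comm Complex.I, Complex.exp_ofReal_mul_I_im]

/-- A truncated fractional moment of a one-dimensional projection is controlled by the
characteristic function at high frequencies. -/
lemma setLIntegral_abs_inner_rpow_le (P : Measure E) [IsProbabilityMeasure P] (e : E)
    {β R : ℝ} (hβ0 : 0 < β) (hβ2 : β ≤ 2) (hR : 0 < R) :
    ∫⁻ x in {x | |⟪e, x⟫| ≤ R⁻¹}, ENNReal.ofReal (|⟪e, x⟫| ^ β / 32) ∂P ≤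
      ∫⁻ u in Set.Ioi R, ENNReal.ofReal (u ^ (-1 - β) *
        (1 - (∫ x, Complex.exp (Complex.I * (⟪u • e, x⟫ : ℂ)) ∂P).re)) := by
  have hmeas : MeasurableSet {x : E | |⟪e, x⟫| ≤ R⁻¹} :=
    measurableSet_le (by fun_prop) measurable_const
  calc ∫⁻ x in {x | |⟪e, x⟫| ≤ R⁻¹}, ENNReal.ofReal (|⟪e, x⟫| ^ β / 32) ∂P
      ≤ ∫⁻ x in {x | |⟪e, x⟫| ≤ R⁻¹}, (∫⁻ u in Set.Ioi R,
          ENNReal.ofReal (u ^ (-1 - β) * (1 - Real.cos (u * ⟪e, x⟫)))) ∂P :=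
        setLIntegral_mono' hmeas fun x hx =>
          ofReal_rpow_div_le_setLIntegral_one_sub_cos hβ0 hβ2 hR hx
    _ ≤ ∫⁻ x, (∫⁻ u in Set.Ioi R,
          ENNReal.ofReal (u ^ (-1 - β) * (1 - Real.cos (u * ⟪e, x⟫)))) ∂P :=
        setLIntegral_le_lintegral _ _
    _ = ∫⁻ u in Set.Ioi R, ∫⁻ x,
          ENNReal.ofReal (u ^ (-1 - β) * (1 - Real.cos (u * ⟪e, x⟫))) ∂P := by
        refine lintegral_lintegral_swap (Measurable.aemeasurable ?_)
        unfold Function.uncurry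
        refine Measurable.ennreal_ofReal (Measurable.mul (by fun_prop) (Measurable.const_sub ?_ _))
        exact Real.measurable_cos.comp (measurable_snd.mul (measurable_const.inner measurable_fst))
    _ = _ := by
        refine setLIntegral_congr_fun measurableSet_Ioi fun u hu => ?_
        have hu0 : 0 < u := hR.trans hu
        have hc : Integrable (fun x => Real.cos ⟪u • e, x⟫) P :=
          Integrable.of_bound (by fun_prop) 1 (.of_forall fun x => Real.abs_cos_le_one _)
        rw [re_integral_exp_I_mul_inner]
        have h1 : (1 : ℝ) - ∫ x, Real.cos ⟪u • e, x⟫ ∂P = ∫ x, (1 - Real.cos ⟪u • e, x⟫) ∂P := by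
          rw [integral_sub (integrable_const _) hc]; simp
        rw [h1, ← integral_const_mul, ofReal_integral_eq_lintegral_ofReal]
        · simp only [inner_smul_left, RCLike.conj_to_real]
        · exact ((integrable_const _).sub hc).const_mul _
        · exact .of_forall fun x =>
            mul_nonneg (Real.rpow_nonneg hu0.le _) (sub_nonneg.2 (Real.cos_le_one _))

omit [MeasurableSpace E] [BorelSpace E] [SecondCountableTopology E] in
lemma norm_rpow_le_sum_abs_inner_rpow {ι : Type*} [Fintype ι] (b : OrthonormalBasis ι ℝ E)
    {β : ℝ} (hβ : 1 ≤ β) (x : E) :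
    ‖x‖ ^ β ≤ (Fintype.card ι : ℝ) ^ (β - 1) * ∑ i, |⟪b i, x⟫| ^ β := by
  have h1 : ‖x‖ ≤ ∑ i, |⟪b i, x⟫| := by
    conv_lhs => rw [← b.sum_repr' x]
    refine (norm_sum_le _ _).trans_eq (Finset.sum_congr rfl fun i _ => ?_)
    rw [norm_smul, b.orthonormal.1 i, mul_one, Real.norm_eq_abs]
  refine (Real.rpow_le_rpow (norm_nonneg _) h1 (by linarith)).trans ?_
  have h2 := Real.rpow_sum_le_const_mul_sum_rpow (Finset.univ : Finset ι)
    (fun i => |⟪b i, x⟫|) hβ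
  simpa using h2

/-- A truncated fractional moment is controlled by the characteristic function at high
frequencies. -/
lemma setLIntegral_norm_rpow_le {ι : Type*} [Fintype ι] (b : OrthonormalBasis ι ℝ E)
    (P : Measure E) [IsProbabilityMeasure P] {β R : ℝ} (hβ1 : 1 ≤ β) (hβ2 : β ≤ 2) (hR : 0 < R) :
    ∫⁻ x in {x | ‖x‖ ≤ R⁻¹}, ENNReal.ofReal (‖x‖ ^ β) ∂P ≤
      ENNReal.ofReal (32 * (Fintype.card ι : ℝ) ^ (β - 1)) *
        ∑ i, ∫⁻ u in Set.Ioi R, ENNReal.ofReal (u ^ (-1 - β) *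
          (1 - (∫ x, Complex.exp (Complex.I * (⟪u • b i, x⟫ : ℂ)) ∂P).re)) := by
  calc ∫⁻ x in {x | ‖x‖ ≤ R⁻¹}, ENNReal.ofReal (‖x‖ ^ β) ∂P
      ≤ ∫⁻ x in {x | ‖x‖ ≤ R⁻¹}, ENNReal.ofReal (32 * (Fintype.card ι : ℝ) ^ (β - 1)) *
          ∑ i, ENNReal.ofReal (|⟪b i, x⟫| ^ β / 32) ∂P := by
        refine lintegral_mono fun x => ?_
        rw [← ENNReal.ofReal_sum_of_nonneg fun i _ => by positivity,
          ← ENNReal.ofReal_mul (by positivity), ← Finset.sum_div]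
        refine ENNReal.ofReal_le_ofReal ((norm_rpow_le_sum_abs_inner_rpow b hβ1 x).trans_eq ?_)
        ring
    _ = ENNReal.ofReal (32 * (Fintype.card ι : ℝ) ^ (β - 1)) *
          ∑ i, ∫⁻ x in {x | ‖x‖ ≤ R⁻¹}, ENNReal.ofReal (|⟪b i, x⟫| ^ β / 32) ∂P := by
        have hm : ∀ i, Measurable fun x => ENNReal.ofReal (|⟪b i, x⟫| ^ β / 32) := fun i => by
          fun_prop
        rw [lintegral_const_mul _ (Finset.measurable_sum _ fun i _ => hm i),
          lintegral_finsetSum _ fun i _ => hm i]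
    _ ≤ _ := by
        gcongr with i
        refine (lintegral_mono_set fun x hx => ?_).trans
          (setLIntegral_abs_inner_rpow_le P (b i) (by linarith) hβ2 hR)
        refine (abs_real_inner_le_norm _ _).trans ?_
        rw [b.orthonormal.1 i, one_mul]
        exact hx

end FractionalMoments

section HighFrequency

variable {E : Type*} [NormedAddCommGroup E] [InnerProductSpace ℝ E]

lemma norm_levyKernel_smul_le {e : E} (he : ‖e‖ = 1) {u : ℝ} (hu : 0 < u) {y : E}
    (hy : ‖y‖ ≤ 1) :
    ‖levyKernel (u • e) y‖ ≤ 2 * min ((u * ‖y‖) ^ (1 : ℝ)) ((u * ‖y‖) ^ (2 : ℝ)) := by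
  have hθ : |⟪u • e, y⟫| ≤ u * ‖y‖ := by
    refine (abs_real_inner_le_norm _ _).trans_eq ?_
    rw [norm_smul, he, Real.norm_of_nonneg hu.le, mul_one]
  rw [levyKernel_of_le _ hy, Real.rpow_one, Real.rpow_two, mul_min_of_nonneg _ _ zero_le_two]
  refine le_min ((norm_exp_I_mul_sub_one_sub_le_linear _).trans (by linarith))
    ((norm_exp_I_mul_sub_one_sub_le_sq _).trans ?_)
  rw [← sq_abs ⟪u • e, y⟫]
  have := pow_le_pow_left₀ (abs_nonneg _) hθ 2
  linarith

lemma one_sub_cos_le_two_mul_min {θ s : ℝ} (hs : |θ| ≤ s) :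
    1 - Real.cos θ ≤ 2 * min (s ^ (0 : ℝ)) (s ^ (2 : ℝ)) := by
  rw [Real.rpow_zero, Real.rpow_two, mul_min_of_nonneg _ _ zero_le_two]
  have h1 := Real.one_sub_sq_div_two_le_cos (x := θ)
  have h2 := pow_le_pow_left₀ (abs_nonneg _) hs 2
  rw [sq_abs] at h2
  exact le_min (by linarith [Real.neg_one_le_cos θ]) (by nlinarith [sq_nonneg s])

/-- If `k u ≤ 2 min ((u s) ^ a) ((u s) ^ b)` when `s ≤ 1` and `k u ≤ 2` otherwise, then the
integral of `u ^ (-1 - β) k u` over `(1, ∞)` is of order `min 1 (s ^ β)`. -/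
lemma setLIntegral_Ioi_one_rpow_mul_le {a b β s : ℝ} (ha0 : 0 ≤ a) (ha : a < β) (hb : β < b)
    (hs : 0 < s) {k : ℝ → ℝ}
    (hk1 : s ≤ 1 → ∀ u, 0 < u → k u ≤ 2 * min ((u * s) ^ a) ((u * s) ^ b))
    (hk2 : 1 < s → ∀ u, 0 < u → k u ≤ 2) :
    ∫⁻ u in Set.Ioi (1 : ℝ), ENNReal.ofReal (u ^ (-1 - β) * k u) ≤
      ENNReal.ofReal ((2 * (1 / (β - a) + 1 / (b - β)) + 2 / β) * min 1 (s ^ β)) := by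
  have hβ : 0 < β := ha0.trans_lt ha
  have hA : 0 ≤ 1 / (β - a) + 1 / (b - β) :=
    add_nonneg (one_div_nonneg.2 (by linarith)) (one_div_nonneg.2 (by linarith))
  rcases le_or_gt s 1 with h | h
  · rw [min_eq_right (Real.rpow_le_one hs.le h hβ.le)]
    calc ∫⁻ u in Set.Ioi (1 : ℝ), ENNReal.ofReal (u ^ (-1 - β) * k u)
        ≤ ∫⁻ u in Set.Ioi (1 : ℝ), ENNReal.ofReal 2 *
            ENNReal.ofReal (u ^ (-1 - β) * min ((u * s) ^ a) ((u * s) ^ b)) := by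
          refine setLIntegral_mono' measurableSet_Ioi fun u hu => ?_
          have hu0 : 0 < u := zero_lt_one.trans hu
          rw [← ENNReal.ofReal_mul zero_le_two]
          refine ENNReal.ofReal_le_ofReal ?_
          have := mul_le_mul_of_nonneg_left (hk1 h u hu0) (Real.rpow_nonneg hu0.le (-1 - β))
          linarith
      _ ≤ ENNReal.ofReal 2 * ∫⁻ u in Set.Ioi (0 : ℝ),
            ENNReal.ofReal (u ^ (-1 - β) * min ((u * s) ^ a) ((u * s) ^ b)) := by
          rw [lintegral_const_mul _ (by fun_prop)]
          gcongr
          exact zero_le_one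
      _ ≤ ENNReal.ofReal 2 * ENNReal.ofReal (s ^ β * (1 / (β - a) + 1 / (b - β))) := by
          gcongr
          exact lintegral_rpow_mul_min_le ha hb hs
      _ ≤ _ := by
          rw [← ENNReal.ofReal_mul zero_le_two]
          refine ENNReal.ofReal_le_ofReal ?_
          have h1 : 0 ≤ 2 / β * s ^ β := by positivity
          nlinarith
  · rw [min_eq_left (Real.one_le_rpow h.le hβ.le), mul_one]
    calc ∫⁻ u in Set.Ioi (1 : ℝ), ENNReal.ofReal (u ^ (-1 - β) * k u)
        ≤ ∫⁻ u in Set.Ioi (1 : ℝ), ENNReal.ofReal 2 * ENNReal.ofReal (u ^ (-1 - β)) := by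
          refine setLIntegral_mono' measurableSet_Ioi fun u hu => ?_
          have hu0 : 0 < u := zero_lt_one.trans hu
          rw [← ENNReal.ofReal_mul zero_le_two]
          refine ENNReal.ofReal_le_ofReal ?_
          have := mul_le_mul_of_nonneg_left (hk2 h u hu0) (Real.rpow_nonneg hu0.le (-1 - β))
          linarith
      _ = ENNReal.ofReal (2 / β) := by
          rw [lintegral_const_mul _ (by fun_prop), setLIntegral_Ioi_rpow (by linarith) one_pos,
            ← ENNReal.ofReal_mul zero_le_two, Real.one_rpow]
          congr 1
          rw [show -1 - β + 1 = -β by ring, neg_div_neg_eq, mul_one_div]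
      _ ≤ _ := ENNReal.ofReal_le_ofReal (by linarith)

variable [MeasurableSpace E] [BorelSpace E] [SecondCountableTopology E]

omit [InnerProductSpace ℝ E] [SecondCountableTopology E] in
lemma integrable_min_one_norm_sq {ν : Measure E} {β : ℝ} (hβ2 : β ≤ 2) (hβ0 : 0 < β)
    (hν : Integrable (fun y => min 1 (‖y‖ ^ β)) ν) :
    Integrable (fun y => min 1 (‖y‖ ^ 2)) ν := by
  refine hν.mono' (by fun_prop) (.of_forall fun y => ?_)
  rw [Real.norm_of_nonneg (by positivity)]
  rcases le_or_gt ‖y‖ 1 with h | h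
  · refine min_le_min_left _ ?_
    rw [← Real.rpow_two]
    rcases eq_or_lt_of_le (norm_nonneg y) with h0 | h0
    · rw [← h0, Real.zero_rpow (by norm_num), Real.zero_rpow hβ0.ne']
    · exact Real.rpow_le_rpow_of_exponent_ge h0 h hβ2
  · rw [min_eq_left (Real.one_le_rpow h.le hβ0.le)]
    exact min_le_left _ _

/-- For `1 < β < 2` the characteristic exponent is integrable at infinity against
`u ^ (-1 - β)` along every direction. -/
lemma setLIntegral_norm_levyExponent_lt_top {ν : Measure E} [SFinite ν] {β : ℝ} (hβ1 : 1 < β)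
    (hβ2 : β < 2) (hν : Integrable (fun y => min 1 (‖y‖ ^ β)) ν) (γ : E) {e : E}
    (he : ‖e‖ = 1) :
    ∫⁻ u in Set.Ioi (1 : ℝ), ENNReal.ofReal (u ^ (-1 - β) * ‖levyExponent ν γ (u • e)‖) < ⊤ := by
  set C := 2 * (1 / (β - 1) + 1 / (2 - β)) + 2 / β with hC
  have hC0 : 0 ≤ C := by
    have h1 : 0 < β - 1 := by linarith
    have h2 : 0 < 2 - β := by linarith
    positivity
  have hker : ∀ y : E, ∫⁻ u in Set.Ioi (1 : ℝ),
      ENNReal.ofReal (u ^ (-1 - β) * ‖levyKernel (u • e) y‖) ≤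
        ENNReal.ofReal (C * min 1 (‖y‖ ^ β)) := fun y => by
    rcases eq_or_ne y 0 with rfl | hy
    · simp [levyKernel]
    · refine setLIntegral_Ioi_one_rpow_mul_le zero_le_one hβ1 hβ2 (norm_pos_iff.2 hy)
        (fun h u hu => norm_levyKernel_smul_le he hu h) (fun h u _ => ?_)
      rw [levyKernel_of_lt _ h]
      exact norm_exp_I_mul_sub_one_le_two _
  have hm : Measurable (Function.uncurry fun (y : E) (u : ℝ) =>
      ENNReal.ofReal (u ^ (-1 - β) * ‖levyKernel (u • e) y‖)) := by
    unfold Function.uncurry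
    exact ((measurable_snd.pow_const _).mul
      ((measurable_snd.smul_const e).levyKernel measurable_fst).norm).ennreal_ofReal
  have hpt : ∀ u ∈ Set.Ioi (1 : ℝ),
      ENNReal.ofReal (u ^ (-1 - β) * ‖levyExponent ν γ (u • e)‖) ≤
        ENNReal.ofReal ‖γ‖ * ENNReal.ofReal (u ^ (-β)) +
          ∫⁻ y, ENNReal.ofReal (u ^ (-1 - β) * ‖levyKernel (u • e) y‖) ∂ν := fun u hu => by
    have hu0 : 0 < u := zero_lt_one.trans hu
    have hup : 0 ≤ u ^ (-1 - β) := Real.rpow_nonneg hu0.le _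
    have hi := (integrable_levyKernel (integrable_min_one_norm_sq hβ2.le (by linarith) hν)
      (u • e)).norm
    rw [← ofReal_integral_eq_lintegral_ofReal (hi.const_mul _)
      (.of_forall fun y => mul_nonneg hup (norm_nonneg _)), integral_const_mul,
      ← ENNReal.ofReal_mul (norm_nonneg _), ← ENNReal.ofReal_add (by positivity)
        (mul_nonneg hup (integral_nonneg fun y => norm_nonneg _))]
    refine ENNReal.ofReal_le_ofReal ?_
    have h1 : ‖levyExponent ν γ (u • e)‖ ≤ u * ‖γ‖ + ∫ y, ‖levyKernel (u • e) y‖ ∂ν := by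
      refine (norm_sub_le _ _).trans (add_le_add ?_ (norm_integral_le_integral_norm _))
      rw [norm_mul, norm_neg, Complex.norm_I, one_mul, Complex.norm_real]
      refine (abs_real_inner_le_norm _ γ).trans_eq ?_
      rw [norm_smul, he, Real.norm_of_nonneg hu0.le, mul_one]
    have h2 : u ^ (-β) = u ^ (-1 - β) * u := by
      rw [← Real.rpow_add_one hu0.ne']; ring_nf
    rw [h2]
    nlinarith
  refine (setLIntegral_mono' measurableSet_Ioi hpt).trans_lt ?_
  rw [lintegral_add_left (by fun_prop), lintegral_const_mul _ (by fun_prop),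
    setLIntegral_Ioi_rpow (by linarith) one_pos]
  refine ENNReal.add_lt_top.2 ⟨ENNReal.mul_lt_top ENNReal.ofReal_lt_top ENNReal.ofReal_lt_top, ?_⟩
  rw [← lintegral_lintegral_swap hm.aemeasurable]
  exact (lintegral_mono hker).trans_lt (hν.const_mul C).lintegral_lt_top

/-- The real part of the characteristic exponent is integrable against `u ^ (-2)` at infinity
when the jumps have bounded variation. -/
lemma setLIntegral_re_levyExponent_lt_top {ν : Measure E} [SFinite ν]
    (hν : Integrable (fun y => min 1 (‖y‖ ^ (1 : ℝ))) ν) (γ : E) {e : E} (he : ‖e‖ = 1) :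
    ∫⁻ u in Set.Ioi (1 : ℝ), ENNReal.ofReal
      (u ^ (-1 - 1 : ℝ) * (levyExponent ν γ (u • e)).re) < ⊤ := by
  have hν2 := integrable_min_one_norm_sq one_le_two one_pos hν
  have hker : ∀ y : E, ∫⁻ u in Set.Ioi (1 : ℝ),
      ENNReal.ofReal (u ^ (-1 - 1 : ℝ) * (1 - Real.cos ⟪u • e, y⟫)) ≤
        ENNReal.ofReal ((2 * (1 / (1 - 0) + 1 / (2 - 1)) + 2 / 1) * min 1 (‖y‖ ^ (1 : ℝ))) :=
    fun y => by
      rcases eq_or_ne y 0 with rfl | hy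
      · simp
      · refine setLIntegral_Ioi_one_rpow_mul_le le_rfl one_pos one_lt_two (norm_pos_iff.2 hy)
          (fun h u hu => one_sub_cos_le_two_mul_min ?_) (fun h u _ => ?_)
        · refine (abs_real_inner_le_norm _ _).trans_eq ?_
          rw [norm_smul, he, Real.norm_of_nonneg hu.le, mul_one]
        · linarith [Real.neg_one_le_cos ⟪u • e, y⟫]
  have hm : Measurable (Function.uncurry fun (y : E) (u : ℝ) =>
      ENNReal.ofReal (u ^ (-1 - 1 : ℝ) * (1 - Real.cos ⟪u • e, y⟫))) := by
    unfold Function.uncurry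
    exact ((measurable_snd.pow_const _).mul ((Real.measurable_cos.comp
      ((measurable_snd.smul_const e).inner measurable_fst)).const_sub 1)).ennreal_ofReal
  have hpt : ∀ u ∈ Set.Ioi (1 : ℝ),
      ENNReal.ofReal (u ^ (-1 - 1 : ℝ) * (levyExponent ν γ (u • e)).re) =
        ∫⁻ y, ENNReal.ofReal (u ^ (-1 - 1 : ℝ) * (1 - Real.cos ⟪u • e, y⟫)) ∂ν := fun u hu => by
    have hu0 : 0 < u := zero_lt_one.trans hu
    have hi : Integrable (fun y => 1 - Real.cos ⟪u • e, y⟫) ν := by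
      have h := (integrable_levyKernel hν2 (u • e)).re.neg
      refine h.congr (.of_forall fun y => ?_)
      have h' := levyKernel_re (u • e) y
      simp [h']
    rw [← ofReal_integral_eq_lintegral_ofReal (hi.const_mul _)
      (.of_forall fun y => mul_nonneg (Real.rpow_nonneg hu0.le _)
        (sub_nonneg.2 (Real.cos_le_one _))), integral_const_mul, levyExponent_re hν2]
  rw [setLIntegral_congr_fun measurableSet_Ioi hpt, ← lintegral_lintegral_swap hm.aemeasurable]
  exact (lintegral_mono hker).trans_lt (hν.const_mul _).lintegral_lt_top

/-- Linear growth of the imaginary part of the characteristic exponent when the jumps have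
bounded variation. -/
lemma abs_levyExponent_im_le {ν : Measure E}
    (hν : Integrable (fun y => min 1 (‖y‖ ^ (1 : ℝ))) ν) (γ : E) {ξ : E} (hξ : 1 ≤ ‖ξ‖) :
    |(levyExponent ν γ ξ).im| ≤ (‖γ‖ + 2 * ∫ y, min 1 (‖y‖ ^ (1 : ℝ)) ∂ν) * ‖ξ‖ := by
  rw [levyExponent_im (integrable_min_one_norm_sq one_le_two one_pos hν), abs_neg]
  have h1 : ‖∫ y, (Real.sin ⟪ξ, y⟫ - (if ‖y‖ ≤ 1 then ⟪ξ, y⟫ else 0)) ∂ν‖ ≤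
      ∫ y, 2 * ‖ξ‖ * min 1 (‖y‖ ^ (1 : ℝ)) ∂ν := by
    refine norm_integral_le_of_norm_le (hν.const_mul _) (.of_forall fun y => ?_)
    rw [Real.norm_eq_abs, Real.rpow_one]
    split_ifs with h
    · rw [min_eq_right h]
      have h2 := abs_real_inner_le_norm ξ y
      have h3 := Real.abs_sin_le_abs (x := ⟪ξ, y⟫)
      have h4 := abs_sub (Real.sin ⟪ξ, y⟫) ⟪ξ, y⟫
      linarith
    · rw [min_eq_left (not_le.1 h).le, sub_zero]
      linarith [Real.abs_sin_le_one ⟪ξ, y⟫]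
  rw [integral_const_mul, Real.norm_eq_abs] at h1
  have h2 := abs_real_inner_le_norm ξ γ
  refine (abs_add_le _ _).trans ?_
  linarith

lemma one_sub_exp_neg_re_le {a : ℂ} (ha : 0 ≤ a.re) {s : ℝ} (hs : |a.im| ≤ s) :
    1 - (Complex.exp (-a)).re ≤ a.re + 2 * min (s ^ (0 : ℝ)) (s ^ (2 : ℝ)) := by
  rw [Complex.exp_re, Complex.neg_re, Complex.neg_im, Real.cos_neg]
  have h1 := one_sub_cos_le_two_mul_min hs
  have h2 := Real.add_one_le_exp (-a.re)
  have h3 : Real.exp (-a.re) ≤ 1 := Real.exp_le_one_iff.2 (by linarith)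
  have h4 := Real.cos_le_one a.im
  nlinarith [Real.exp_pos (-a.re)]

end HighFrequency

section SmallBalls

lemma tendsto_setLIntegral_Ioi_atTop_zero {f : ℝ → ℝ≥0∞} {a : ℝ}
    (hf : ∫⁻ u in Set.Ioi a, f u < ⊤) :
    Tendsto (fun R : ℝ => ∫⁻ u in Set.Ioi R, f u) atTop (𝓝 0) := by
  have h := tendsto_measure_iInter_atTop (μ := volume.withDensity f)
    (s := fun R : ℝ => Set.Ioi R) (fun R => measurableSet_Ioi.nullMeasurableSet)
    (fun R S hRS => Set.Ioi_subset_Ioi hRS)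
    ⟨a, by rw [withDensity_apply _ measurableSet_Ioi]; exact hf.ne⟩
  have h0 : ⋂ R : ℝ, Set.Ioi R = ∅ :=
    Set.eq_empty_of_forall_notMem fun x hx => lt_irrefl x (Set.mem_iInter.1 hx x)
  rw [h0, measure_empty] at h
  exact h.congr fun R => withDensity_apply _ measurableSet_Ioi

variable {E : Type*} [NormedAddCommGroup E] [InnerProductSpace ℝ E] [FiniteDimensional ℝ E]
  [MeasurableSpace E] [BorelSpace E] {ν : Measure E} [SFinite ν]

/-- For `1 < β < 2` the `β`-moment of an infinitely divisible family on small balls is `o(t)`,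
uniformly in time. -/
lemma exists_setLIntegral_norm_rpow_le {β : ℝ} (hβ1 : 1 < β) (hβ2 : β < 2)
    (hν : Integrable (fun y => min 1 (‖y‖ ^ β)) ν) (γ : E) {ε : ℝ} (hε : 0 < ε) :
    ∃ δ : ℝ, 0 < δ ∧ ∀ t : ℝ, 0 < t → ∀ (P : Measure E) [IsProbabilityMeasure P],
      (∀ ξ, ∫ x, Complex.exp (Complex.I * (⟪ξ, x⟫ : ℂ)) ∂P =
        Complex.exp (-(t : ℂ) * levyExponent ν γ ξ)) →
      ∫⁻ x in {x | ‖x‖ ≤ δ}, ENNReal.ofReal (‖x‖ ^ β) ∂P ≤ ENNReal.ofReal (ε * t) := by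
  have hν2 := integrable_min_one_norm_sq hβ2.le (by linarith) hν
  let b := stdOrthonormalBasis ℝ E
  set A := 32 * (Fintype.card (Fin (Module.finrank ℝ E)) : ℝ) ^ (β - 1)
  have hlim : Tendsto (fun R : ℝ => ENNReal.ofReal A * ∑ i, ∫⁻ u in Set.Ioi R,
      ENNReal.ofReal (u ^ (-1 - β) * ‖levyExponent ν γ (u • b i)‖)) atTop (𝓝 0) := by
    have h := tendsto_finsetSum Finset.univ fun i _ => tendsto_setLIntegral_Ioi_atTop_zero
      (setLIntegral_norm_levyExponent_lt_top hβ1 hβ2 hν γ (b.orthonormal.1 i))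
    simpa using ENNReal.Tendsto.const_mul h (.inr ENNReal.ofReal_ne_top)
  obtain ⟨R, hR, hR0⟩ := ((hlim.eventually_lt_const (ENNReal.ofReal_pos.2 hε)).and
    (eventually_gt_atTop 0)).exists
  refine ⟨R⁻¹, inv_pos.2 hR0, fun t ht P _ hP => ?_⟩
  have hpt : ∀ i, ∫⁻ u in Set.Ioi R, ENNReal.ofReal (u ^ (-1 - β) *
      (1 - (∫ x, Complex.exp (Complex.I * (⟪u • b i, x⟫ : ℂ)) ∂P).re)) ≤
      ENNReal.ofReal t * ∫⁻ u in Set.Ioi R,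
        ENNReal.ofReal (u ^ (-1 - β) * ‖levyExponent ν γ (u • b i)‖) := fun i => by
    rw [← lintegral_const_mul' _ _ ENNReal.ofReal_ne_top]
    refine setLIntegral_mono' measurableSet_Ioi fun u hu => ?_
    have hu0 : 0 < u := hR0.trans hu
    rw [← ENNReal.ofReal_mul ht.le]
    refine ENNReal.ofReal_le_ofReal ?_
    have h1 : 1 - (∫ x, Complex.exp (Complex.I * (⟪u • b i, x⟫ : ℂ)) ∂P).re ≤
        t * ‖levyExponent ν γ (u • b i)‖ := by
      rw [hP]
      have h2 := Complex.norm_exp_neg_sub_exp_neg_le (a := 0)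
        (b := (t : ℂ) * levyExponent ν γ (u • b i)) le_rfl (by
          rw [Complex.re_ofReal_mul]
          exact mul_nonneg ht.le (levyExponent_re_nonneg hν2 γ _))
      rw [neg_zero, Complex.exp_zero, zero_sub, norm_neg, norm_mul, Complex.norm_real,
        Real.norm_of_nonneg ht.le, ← neg_mul] at h2
      refine le_trans ?_ h2
      simpa using Complex.re_le_norm
        (1 - Complex.exp (-(t : ℂ) * levyExponent ν γ (u • b i)))
    calc u ^ (-1 - β) * (1 - (∫ x, Complex.exp (Complex.I * (⟪u • b i, x⟫ : ℂ)) ∂P).re)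
        ≤ u ^ (-1 - β) * (t * ‖levyExponent ν γ (u • b i)‖) :=
          mul_le_mul_of_nonneg_left h1 (Real.rpow_nonneg hu0.le _)
      _ = t * (u ^ (-1 - β) * ‖levyExponent ν γ (u • b i)‖) := by ring
  refine (setLIntegral_norm_rpow_le b P hβ1.le hβ2.le hR0).trans ?_
  calc _ ≤ ENNReal.ofReal A * ∑ i, ENNReal.ofReal t * ∫⁻ u in Set.Ioi R,
        ENNReal.ofReal (u ^ (-1 - β) * ‖levyExponent ν γ (u • b i)‖) := by
        gcongr with i
        exact hpt i
    _ = (ENNReal.ofReal A * ∑ i, ∫⁻ u in Set.Ioi R,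
        ENNReal.ofReal (u ^ (-1 - β) * ‖levyExponent ν γ (u • b i)‖)) * ENNReal.ofReal t := by
        rw [← Finset.mul_sum]; ring
    _ ≤ ENNReal.ofReal ε * ENNReal.ofReal t := by gcongr
    _ = ENNReal.ofReal (ε * t) := (ENNReal.ofReal_mul hε.le).symm

/-- If the jumps have bounded variation, the first moment of an infinitely divisible family on
the unit ball is `O(t)`, uniformly in time. -/
lemma exists_setLIntegral_norm_le
    (hν : Integrable (fun y => min 1 (‖y‖ ^ (1 : ℝ))) ν) (γ : E) :
    ∃ K : ℝ, 0 ≤ K ∧ ∀ t : ℝ, 0 < t → ∀ (P : Measure E) [IsProbabilityMeasure P],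
      (∀ ξ, ∫ x, Complex.exp (Complex.I * (⟪ξ, x⟫ : ℂ)) ∂P =
        Complex.exp (-(t : ℂ) * levyExponent ν γ ξ)) →
      ∫⁻ x in {x | ‖x‖ ≤ 1}, ENNReal.ofReal (‖x‖ ^ (1 : ℝ)) ∂P ≤ ENNReal.ofReal (K * t) := by
  have hν2 := integrable_min_one_norm_sq one_le_two one_pos hν
  let b := stdOrthonormalBasis ℝ E
  set c := ‖γ‖ + 2 * ∫ y, min 1 (‖y‖ ^ (1 : ℝ)) ∂ν + 1 with hc
  have hc0 : 0 < c := by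
    have : 0 ≤ ∫ y, min 1 (‖y‖ ^ (1 : ℝ)) ∂ν := integral_nonneg fun y => by positivity
    positivity
  set B : ℝ≥0∞ := ENNReal.ofReal (32 *
      (Fintype.card (Fin (Module.finrank ℝ E)) : ℝ) ^ ((1 : ℝ) - 1)) *
    ∑ i, ((∫⁻ u in Set.Ioi (1 : ℝ), ENNReal.ofReal
      (u ^ (-1 - 1 : ℝ) * (levyExponent ν γ (u • b i)).re)) + ENNReal.ofReal (4 * c)) with hB
  have hBtop : B ≠ ⊤ := ENNReal.mul_ne_top ENNReal.ofReal_ne_top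
    (ENNReal.sum_ne_top.2 fun i _ => ENNReal.add_ne_top.2
      ⟨(setLIntegral_re_levyExponent_lt_top hν γ (b.orthonormal.1 i)).ne, ENNReal.ofReal_ne_top⟩)
  refine ⟨B.toReal, ENNReal.toReal_nonneg, fun t ht P _ hP => ?_⟩
  have hpt : ∀ i, ∫⁻ u in Set.Ioi (1 : ℝ), ENNReal.ofReal (u ^ (-1 - 1 : ℝ) *
      (1 - (∫ x, Complex.exp (Complex.I * (⟪u • b i, x⟫ : ℂ)) ∂P).re)) ≤
      ENNReal.ofReal t * ((∫⁻ u in Set.Ioi (1 : ℝ), ENNReal.ofReal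
        (u ^ (-1 - 1 : ℝ) * (levyExponent ν γ (u • b i)).re)) + ENNReal.ofReal (4 * c)) :=
    fun i => by
    have hs : 0 < t * c := mul_pos ht hc0
    calc _ ≤ ∫⁻ u in Set.Ioi (1 : ℝ), (ENNReal.ofReal t * ENNReal.ofReal
            (u ^ (-1 - 1 : ℝ) * (levyExponent ν γ (u • b i)).re) + ENNReal.ofReal 2 *
          ENNReal.ofReal (u ^ (-1 - 1 : ℝ) *
            min ((u * (t * c)) ^ (0 : ℝ)) ((u * (t * c)) ^ (2 : ℝ)))) := by
          refine setLIntegral_mono' measurableSet_Ioi fun u hu => ?_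
          have hu0 : 0 < u := zero_lt_one.trans hu
          have hup : 0 ≤ u ^ (-1 - 1 : ℝ) := Real.rpow_nonneg hu0.le _
          have hre := levyExponent_re_nonneg hν2 γ (u • b i)
          rw [← ENNReal.ofReal_mul ht.le, ← ENNReal.ofReal_mul zero_le_two,
            ← ENNReal.ofReal_add (by positivity) (by positivity)]
          refine ENNReal.ofReal_le_ofReal ?_
          have hnorm : ‖u • b i‖ = u := by
            rw [norm_smul, b.orthonormal.1 i, mul_one, Real.norm_of_nonneg hu0.le]
          have him := abs_levyExponent_im_le hν γ (ξ := u • b i) (by rw [hnorm]; exact hu.le)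
          rw [hnorm] at him
          have h1 := one_sub_exp_neg_re_le (a := (t : ℂ) * levyExponent ν γ (u • b i))
            (s := u * (t * c)) (by rw [Complex.re_ofReal_mul]; positivity) (by
              rw [Complex.im_ofReal_mul, abs_mul, abs_of_pos ht]
              have := mul_le_mul_of_nonneg_left him ht.le
              have h2 : 0 ≤ t * u := by positivity
              rw [hc]
              linarith)
          rw [Complex.re_ofReal_mul] at h1
          rw [hP, neg_mul]
          have := mul_le_mul_of_nonneg_left h1 hup
          linarith
      _ = ENNReal.ofReal t * (∫⁻ u in Set.Ioi (1 : ℝ), ENNReal.ofReal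
            (u ^ (-1 - 1 : ℝ) * (levyExponent ν γ (u • b i)).re)) +
          ENNReal.ofReal 2 * ∫⁻ u in Set.Ioi (1 : ℝ), ENNReal.ofReal (u ^ (-1 - 1 : ℝ) *
            min ((u * (t * c)) ^ (0 : ℝ)) ((u * (t * c)) ^ (2 : ℝ))) := by
          rw [lintegral_add_right _ (by fun_prop), lintegral_const_mul' _ _ ENNReal.ofReal_ne_top,
            lintegral_const_mul' _ _ ENNReal.ofReal_ne_top]
      _ ≤ ENNReal.ofReal t * (∫⁻ u in Set.Ioi (1 : ℝ), ENNReal.ofReal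
            (u ^ (-1 - 1 : ℝ) * (levyExponent ν γ (u • b i)).re)) +
          ENNReal.ofReal 2 * ENNReal.ofReal
            ((t * c) ^ (1 : ℝ) * (1 / (1 - 0) + 1 / (2 - 1))) := by
          gcongr
          exact (lintegral_mono_set (Set.Ioi_subset_Ioi zero_le_one)).trans
            (lintegral_rpow_mul_min_le one_pos one_lt_two hs)
      _ = _ := by
          rw [mul_add (ENNReal.ofReal t), ← ENNReal.ofReal_mul zero_le_two, ← ENNReal.ofReal_mul ht.le,
            Real.rpow_one]
          congr 2
          ring
  have h := setLIntegral_norm_rpow_le b P le_rfl one_le_two one_pos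
  rw [inv_one] at h
  refine h.trans ?_
  calc _ ≤ ENNReal.ofReal (32 *
        (Fintype.card (Fin (Module.finrank ℝ E)) : ℝ) ^ ((1 : ℝ) - 1)) *
        ∑ i, ENNReal.ofReal t * ((∫⁻ u in Set.Ioi (1 : ℝ), ENNReal.ofReal
          (u ^ (-1 - 1 : ℝ) * (levyExponent ν γ (u • b i)).re)) + ENNReal.ofReal (4 * c)) := by
        gcongr with i
        exact hpt i
    _ = B * ENNReal.ofReal t := by
        rw [← Finset.mul_sum, hB]; ring
    _ = ENNReal.ofReal (B.toReal * t) := by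
        rw [ENNReal.ofReal_mul ENNReal.toReal_nonneg, ENNReal.ofReal_toReal hBtop]

end SmallBalls

section SmallTimeLimit

variable {E : Type*} [NormedAddCommGroup E] [InnerProductSpace ℝ E] [FiniteDimensional ℝ E]
  [MeasurableSpace E] [BorelSpace E] {ν : Measure E} [SFinite ν] {γ : E}

/-- A function of order `‖x‖ ^ β` with vanishing derivative at the origin has integral `o(t)` on
small balls, uniformly in time. -/
lemma exists_setLIntegral_abs_le {β : ℝ} (hβ1 : 1 ≤ β) (hβ2 : β < 2)
    (hν : Integrable (fun y => min 1 (‖y‖ ^ β)) ν) {h : E → ℝ} {C : ℝ} (hC : 0 < C)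
    (hh : ∀ x, ‖x‖ < 1 → |h x| ≤ C * ‖x‖ ^ β) (ho : h =o[𝓝 0] fun x : E => x)
    {ε : ℝ} (hε : 0 < ε) :
    ∃ δ : ℝ, 0 < δ ∧ ∀ t : ℝ, 0 < t → ∀ (P : Measure E) [IsProbabilityMeasure P],
      (∀ ξ, ∫ x, Complex.exp (Complex.I * (⟪ξ, x⟫ : ℂ)) ∂P =
        Complex.exp (-(t : ℂ) * levyExponent ν γ ξ)) →
      ∫⁻ x in {x | ‖x‖ ≤ δ}, ENNReal.ofReal |h x| ∂P ≤ ENNReal.ofReal (ε * t) := by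
  have hmeas : ∀ δ : ℝ, MeasurableSet {x : E | ‖x‖ ≤ δ} := fun δ =>
    measurableSet_le measurable_norm measurable_const
  have key : ∀ (P : Measure E) {c δ a s : ℝ}, 0 ≤ c → c * s ≤ a →
      (∀ x : E, ‖x‖ ≤ δ → |h x| ≤ c * ‖x‖ ^ β) →
      ∫⁻ x in {x | ‖x‖ ≤ δ}, ENNReal.ofReal (‖x‖ ^ β) ∂P ≤ ENNReal.ofReal s →
      ∫⁻ x in {x | ‖x‖ ≤ δ}, ENNReal.ofReal |h x| ∂P ≤ ENNReal.ofReal a :=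
    fun P c δ a s hc hcs hx hs => by
      calc ∫⁻ x in {x | ‖x‖ ≤ δ}, ENNReal.ofReal |h x| ∂P
          ≤ ∫⁻ x in {x | ‖x‖ ≤ δ}, ENNReal.ofReal c * ENNReal.ofReal (‖x‖ ^ β) ∂P := by
            refine setLIntegral_mono' (hmeas δ) fun x hxδ => ?_
            rw [← ENNReal.ofReal_mul hc]
            exact ENNReal.ofReal_le_ofReal (hx x hxδ)
        _ ≤ ENNReal.ofReal c * ENNReal.ofReal s := by
            rw [lintegral_const_mul' _ _ ENNReal.ofReal_ne_top]
            gcongr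
        _ ≤ ENNReal.ofReal a := by
            rw [← ENNReal.ofReal_mul hc]
            exact ENNReal.ofReal_le_ofReal hcs
  have hmono : ∀ (P : Measure E) {δ δ' : ℝ} {a : ℝ≥0∞}, δ' ≤ δ →
      ∫⁻ x in {x | ‖x‖ ≤ δ}, ENNReal.ofReal (‖x‖ ^ β) ∂P ≤ a →
      ∫⁻ x in {x | ‖x‖ ≤ δ'}, ENNReal.ofReal (‖x‖ ^ β) ∂P ≤ a := fun P δ δ' a hδ ha =>
    (lintegral_mono_set fun x (hx : ‖x‖ ≤ δ') => hx.trans hδ).trans ha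
  rcases hβ1.eq_or_lt with rfl | hβ1
  · obtain ⟨K, hK0, hK⟩ := exists_setLIntegral_norm_le hν γ
    have hη : 0 < ε / (K + 1) := by positivity
    obtain ⟨δ, hδ, hδ'⟩ := Metric.eventually_nhds_iff.1 (ho.def hη)
    refine ⟨min (δ / 2) 1, by positivity, fun t ht P _ hP => key P hη.le ?_ (fun x hx => ?_)
      (hmono P (min_le_right _ _) (hK t ht P hP))⟩
    · rw [div_mul_eq_mul_div, div_le_iff₀ (by positivity)]
      nlinarith [mul_pos hε ht]
    · have h1 := hδ' (y := x) (by
        rw [dist_zero_right]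
        linarith [hx.trans (min_le_left _ _)])
      rwa [Real.norm_eq_abs, ← Real.rpow_one ‖x‖] at h1
  · obtain ⟨δ, hδ, hδ'⟩ := exists_setLIntegral_norm_rpow_le hβ1 hβ2 hν γ (div_pos hε hC)
    refine ⟨min δ (1 / 2), by positivity, fun t ht P _ hP => key P hC.le ?_ (fun x hx => hh x ?_)
      (hmono P (min_le_left _ _) (hδ' t ht P hP))⟩
    · exact (by field_simp : C * (ε / C * t) = ε * t).le
    · linarith [hx.trans (min_le_right _ _)]

variable {t : ℕ → ℝ} {P : ℕ → Measure E} [∀ n, IsProbabilityMeasure (P n)]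

/-- Small-time asymptotics of `∫ h dP` for bounded continuous `h` whose contribution near the
origin is negligible. -/
lemma tendsto_inv_mul_integral_of_small_near_zero
    (hν : Integrable (fun y => min 1 (‖y‖ ^ 2)) ν) (ht0 : ∀ n, 0 < t n)
    (ht : Tendsto t atTop (𝓝 0))
    (hP : ∀ n ξ, ∫ x, Complex.exp (Complex.I * (⟪ξ, x⟫ : ℂ)) ∂(P n) =
      Complex.exp (-(t n : ℂ) * levyExponent ν γ ξ))
    {h : E → ℝ} (hh : Continuous h) {M : ℝ} (hM : ∀ x, |h x| ≤ M) (h0 : h 0 = 0)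
    (hint : Integrable h ν)
    (hsmall : ∀ ε : ℝ, 0 < ε → ∃ δ : ℝ, 0 < δ ∧ ∀ n,
      ∫⁻ x in {x | ‖x‖ ≤ δ}, ENNReal.ofReal |h x| ∂(P n) ≤ ENNReal.ofReal (ε * t n)) :
    Tendsto (fun n => (t n)⁻¹ * ∫ x, h x ∂(P n)) atTop (𝓝 (∫ x, h x ∂ν)) := by
  let χ : ℕ → E → ℝ := fun k x => min 1 (max 0 (k * ‖x‖ - 1))
  have hχc : ∀ k, Continuous (χ k) := fun k => by fun_prop
  have hχ0 : ∀ k x, 0 ≤ χ k x := fun k x => le_min zero_le_one (le_max_left _ _)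
  have hχ1 : ∀ k x, χ k x ≤ 1 := fun k x => min_le_left _ _
  have hχ_one : ∀ (k : ℕ) (x : E), 2 ≤ k * ‖x‖ → χ k x = 1 := fun k x hx =>
    min_eq_left (le_max_of_le_right (by linarith))
  have hfc : ∀ k, Continuous fun x => h x * χ k x := fun k => hh.mul (hχc k)
  have hle : ∀ k x, |h x * χ k x| ≤ |h x| := fun k x => by
    rw [abs_mul, abs_of_nonneg (hχ0 k x)]
    exact mul_le_of_le_one_right (abs_nonneg _) (hχ1 k x)
  have hlim : Tendsto (fun k => ∫ x, h x * χ k x ∂ν) atTop (𝓝 (∫ x, h x ∂ν)) := by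
    refine tendsto_integral_of_dominated_convergence (fun x => |h x|)
      (fun k => (hfc k).aestronglyMeasurable) hint.abs
      (fun k => .of_forall (hle k)) (.of_forall fun x => ?_)
    rcases eq_or_ne x 0 with rfl | hx
    · simp [h0]
    · refine tendsto_const_nhds.congr' ?_
      filter_upwards [(tendsto_natCast_atTop_atTop.atTop_mul_const
        (norm_pos_iff.2 hx)).eventually_ge_atTop 2] with k hk
      rw [hχ_one k x hk, mul_one]
  rw [Metric.tendsto_atTop']
  intro ε hε
  obtain ⟨δ, hδ, hsm⟩ := hsmall (ε / 3) (by positivity)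
  obtain ⟨k, ⟨hk1, hk2⟩, hk0⟩ := (((hlim.eventually (Metric.ball_mem_nhds _
    (by positivity : 0 < ε / 3))).and ((tendsto_natCast_atTop_atTop.atTop_mul_const
      hδ).eventually_ge_atTop 2)).and (eventually_gt_atTop 0)).exists
  have hk0' : (0 : ℝ) < k := Nat.cast_pos.2 hk0
  have hk3 := tendsto_inv_mul_integral_of_eq_zero_near_zero hν ht0 ht hP (hfc k)
    (fun x => (hle k x).trans (hM x)) (inv_pos.2 hk0') (fun x hx => by
      have h1 : (k : ℝ) * ‖x‖ < 1 := by
        have := mul_lt_mul_of_pos_left hx hk0'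
        rwa [mul_inv_cancel₀ hk0'.ne'] at this
      have h2 : χ k x = 0 := by
        simp only [χ]
        rw [max_eq_left (by linarith), min_eq_right zero_le_one]
      rw [h2, mul_zero])
  obtain ⟨N, hN⟩ := Metric.tendsto_atTop'.1 hk3 (ε / 3) (by positivity)
  refine ⟨N, fun n hn => ?_⟩
  have hiP : ∀ f : E → ℝ, Continuous f → (∀ x, |f x| ≤ M) → Integrable f (P n) :=
    fun f hf hfM => Integrable.of_bound hf.aestronglyMeasurable M (.of_forall hfM)
  have hdiff : |∫ x, h x ∂(P n) - ∫ x, h x * χ k x ∂(P n)| ≤ ε / 3 * t n := by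
    rw [← integral_sub (hiP h hh hM)
      (hiP _ (hfc k) fun x => (hle k x).trans (hM x)), ← Real.norm_eq_abs]
    refine (norm_integral_le_lintegral_norm _).trans (ENNReal.toReal_le_of_le_ofReal
      (mul_nonneg (by positivity) (ht0 n).le) (le_trans ?_ (hsm n)))
    rw [← lintegral_indicator (measurableSet_le measurable_norm measurable_const)]
    refine lintegral_mono fun x => ?_
    by_cases hx : ‖x‖ ≤ δ
    · rw [Set.indicator_of_mem (by exact hx)]
      refine ENNReal.ofReal_le_ofReal ?_
      rw [Real.norm_eq_abs, ← mul_one_sub, abs_mul, abs_of_nonneg (sub_nonneg.2 (hχ1 k x))]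
      exact mul_le_of_le_one_right (abs_nonneg _) (by linarith [hχ0 k x])
    · rw [hχ_one k x (hk2.trans (mul_le_mul_of_nonneg_left (not_le.1 hx).le hk0'.le))]
      simp
  have hdiff' : |(t n)⁻¹ * ∫ x, h x ∂(P n) - (t n)⁻¹ * ∫ x, h x * χ k x ∂(P n)| ≤ ε / 3 := by
    rw [← mul_sub, abs_mul, abs_of_pos (inv_pos.2 (ht0 n)), inv_mul_le_iff₀ (ht0 n), mul_comm]
    exact hdiff
  have h3 := hN n hn
  rw [Real.dist_eq] at *
  calc |(t n)⁻¹ * ∫ x, h x ∂(P n) - ∫ x, h x ∂ν|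
      ≤ |(t n)⁻¹ * ∫ x, h x ∂(P n) - (t n)⁻¹ * ∫ x, h x * χ k x ∂(P n)| +
        |(t n)⁻¹ * ∫ x, h x * χ k x ∂(P n) - ∫ x, h x * χ k x ∂ν| +
        |∫ x, h x * χ k x ∂ν - ∫ x, h x ∂ν| :=
        (abs_sub_le _ _ _).trans (by gcongr; exact abs_sub_le _ _ _)
    _ < ε := by linarith

omit [SFinite ν] in
/-- Small-time asymptotics of the integral of a sine of a linear form. -/
lemma tendsto_inv_mul_integral_sin
    (hν : Integrable (fun y => min 1 (‖y‖ ^ 2)) ν) (ht0 : ∀ n, 0 < t n)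
    (ht : Tendsto t atTop (𝓝 0))
    (hP : ∀ n ξ, ∫ x, Complex.exp (Complex.I * (⟪ξ, x⟫ : ℂ)) ∂(P n) =
      Complex.exp (-(t n : ℂ) * levyExponent ν γ ξ)) (ξ : E) :
    Tendsto (fun n => (t n)⁻¹ * ∫ x, Real.sin ⟪ξ, x⟫ ∂(P n)) atTop
      (𝓝 (⟪ξ, γ⟫ + ∫ y, (Real.sin ⟪ξ, y⟫ - (if ‖y‖ ≤ 1 then ⟪ξ, y⟫ else 0)) ∂ν)) := by
  have h := (Complex.continuous_im.tendsto _).comp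
    (tendsto_inv_mul_exp_neg_mul_sub_one ht0 ht (levyExponent ν γ ξ))
  rw [Complex.neg_im, levyExponent_im hν, neg_neg] at h
  refine h.congr fun n => ?_
  rw [← im_integral_exp_I_mul_inner, hP, Function.comp_apply, ← Complex.ofReal_inv,
    Complex.im_ofReal_mul, Complex.sub_im, Complex.one_im, sub_zero]

end SmallTimeLimit

section Remainder

variable {E : Type*} [NormedAddCommGroup E] [InnerProductSpace ℝ E]

lemma abs_sin_sub_le_two_mul_sq (θ : ℝ) : |Real.sin θ - θ| ≤ 2 * θ ^ 2 := by
  have h := (Complex.abs_im_le_norm _).trans (norm_exp_I_mul_sub_one_sub_le_sq θ)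
  rw [mul_comm Complex.I] at h
  simpa [Complex.exp_ofReal_mul_I_im] using h

lemma isLittleO_sub_sub_sin [CompleteSpace E] {r : E → ℝ} {ξ : E} (hr : HasGradientAt r ξ 0) :
    (fun x => r x - r 0 - Real.sin ⟪ξ, x⟫) =o[𝓝 0] fun x : E => x := by
  have h1 : (fun x => r x - r 0 - ⟪ξ, x⟫) =o[𝓝 0] fun x : E => x := by
    simpa using hasGradientAt_iff_isLittleO.1 hr
  have h2 : (fun x => Real.sin ⟪ξ, x⟫ - ⟪ξ, x⟫) =O[𝓝 0] fun x : E => ‖x‖ ^ 2 := by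
    refine Asymptotics.IsBigO.of_bound (2 * ‖ξ‖ ^ 2) (.of_forall fun x => ?_)
    rw [Real.norm_eq_abs, norm_pow, norm_norm]
    refine (abs_sin_sub_le_two_mul_sq _).trans ?_
    rw [mul_assoc, ← mul_pow, ← sq_abs]
    gcongr
    exact abs_real_inner_le_norm _ _
  have h3 : (fun x : E => ‖x‖ ^ 2) =o[𝓝 0] fun x : E => x :=
    Asymptotics.isLittleO_norm_pow_id one_lt_two
  refine (h1.sub (h2.trans_isLittleO h3)).congr_left fun x => ?_
  ring

lemma abs_sub_sub_sin_le {r : E → ℝ} {ξ : E} {C β : ℝ} (hβ2 : β ≤ 2) {x : E} (hx : ‖x‖ < 1)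
    (hβ0 : 0 < β) (hr : |r x - r 0 - ⟪ξ, x⟫| ≤ C * ‖x‖ ^ β) :
    |r x - r 0 - Real.sin ⟪ξ, x⟫| ≤ (C + 2 * ‖ξ‖ ^ 2) * ‖x‖ ^ β := by
  have h1 : ‖x‖ ^ 2 ≤ ‖x‖ ^ β := by
    rcases (norm_nonneg x).eq_or_lt with h0 | h0
    · simp [← h0, Real.zero_rpow hβ0.ne']
    · rw [← Real.rpow_two]
      exact Real.rpow_le_rpow_of_exponent_ge h0 hx.le hβ2
  have h2 : ⟪ξ, x⟫ ^ 2 ≤ ‖ξ‖ ^ 2 * ‖x‖ ^ 2 := by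
    rw [← mul_pow, ← sq_abs]
    gcongr
    exact abs_real_inner_le_norm _ _
  have h3 := abs_sin_sub_le_two_mul_sq ⟪ξ, x⟫
  have h4 := abs_sub (r x - r 0 - ⟪ξ, x⟫) (Real.sin ⟪ξ, x⟫ - ⟪ξ, x⟫)
  rw [sub_sub_sub_cancel_right] at h4
  nlinarith [mul_le_mul_of_nonneg_left h1 (sq_nonneg ‖ξ‖)]

variable [MeasurableSpace E]

omit [InnerProductSpace ℝ E] in
/-- A bounded function of order `‖x‖ ^ β` near the origin is integrable for a measure with
finite truncated `β`-moment. -/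
lemma integrable_of_abs_le_rpow_near_zero {ν : Measure E} {β : ℝ} (hβ0 : 0 < β)
    (hν : Integrable (fun y => min 1 (‖y‖ ^ β)) ν) {h : E → ℝ} (hm : AEStronglyMeasurable h ν)
    {M C : ℝ} (hC : 0 ≤ C) (hM : ∀ x, |h x| ≤ M) (hh : ∀ x, ‖x‖ < 1 → |h x| ≤ C * ‖x‖ ^ β) :
    Integrable h ν := by
  have hM0 : 0 ≤ M := (abs_nonneg _).trans (hM 0)
  refine (hν.const_mul (C + M)).mono' hm (.of_forall fun x => ?_)
  rw [Real.norm_eq_abs]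
  rcases lt_or_ge ‖x‖ 1 with hx | hx
  · rw [min_eq_right (Real.rpow_le_one (norm_nonneg _) hx.le hβ0.le)]
    have := hh x hx
    have h1 : 0 ≤ M * ‖x‖ ^ β := by positivity
    linarith
  · rw [min_eq_left (Real.one_le_rpow hx hβ0.le)]
    linarith [hM x]

variable [BorelSpace E]

omit [InnerProductSpace ℝ E] in
lemma integrable_min_one_rpow_of_lintegral_lt_top {ν : Measure E} {β : ℝ}
    (hν : ∫⁻ y, ENNReal.ofReal (min 1 (‖y‖ ^ 2)) ∂ν < ⊤)
    (hνβ : ∫⁻ y in {y : E | ‖y‖ < 1}, ENNReal.ofReal (‖y‖ ^ β) ∂ν < ⊤) :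
    Integrable (fun y => min 1 (‖y‖ ^ β)) ν := by
  have hmeas : MeasurableSet {y : E | ‖y‖ < 1} := measurableSet_lt measurable_norm measurable_const
  refine ⟨(measurable_const.min (measurable_norm.pow_const _)).aestronglyMeasurable, ?_⟩
  rw [hasFiniteIntegral_iff_ofReal (.of_forall fun y => by positivity),
    ← lintegral_add_compl _ hmeas]
  refine ENNReal.add_lt_top.2 ⟨lt_of_le_of_lt (lintegral_mono fun y => ?_) hνβ,
    lt_of_le_of_lt (setLIntegral_mono' hmeas.compl fun y hy => ?_)
      ((setLIntegral_le_lintegral _ _).trans_lt hν)⟩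
  · exact ENNReal.ofReal_le_ofReal (min_le_right _ _)
  · have hy1 : 1 ≤ ‖y‖ := not_lt.1 hy
    rw [min_eq_left (one_le_pow₀ hy1)]
    exact ENNReal.ofReal_le_ofReal (min_le_left _ _)

end Remainder

/-- Theorem 1, case 2(ii) (1 ≤ β < 2, arbitrary Lévy process with triplet (0, γ, ν)):
if ∫_{‖x‖<1} ‖x‖^β ν(dx) < ∞, the function r = g ∗ μ̌ is bounded continuous,
differentiable at 0 and |r(x) − r(0) − ⟨x, ∇r(0)⟩| ≤ C‖x‖^β near 0, then
t⁻¹(H_g^μ(t) − H_g^μ(0)) → ⟨γ, ∇r(0)⟩ + ∫ (r(x) − r(0) − ⟨x, ∇r(0)⟩1_{‖x‖≤1}) ν(dx). -/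
theorem heat_content_general_levy_beta
    (d : ℕ) (hd : 1 ≤ d) (β : ℝ) (hβ1 : 1 ≤ β) (hβ2 : β < 2)
    -- ν is a Lévy measure with the β-moment condition near 0
    (ν : Measure (EuclideanSpace ℝ (Fin d)))
    (hν0 : ν {0} = 0)
    (hνlevy : ∫⁻ y, ENNReal.ofReal (min 1 (‖y‖ ^ 2)) ∂ν < ⊤)
    (hνβ : ∫⁻ y in {y : EuclideanSpace ℝ (Fin d) | ‖y‖ < 1},
      ENNReal.ofReal (‖y‖ ^ β) ∂ν < ⊤)
    (γ : EuclideanSpace ℝ (Fin d))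
    -- the characteristic exponent of the Lévy process with triplet (0, γ, ν)
    (ψ : EuclideanSpace ℝ (Fin d) → ℂ)
    (hψ : ∀ ξ, ψ ξ = -Complex.I * (⟪ξ, γ⟫ : ℂ)
      - ∫ y, (Complex.exp (Complex.I * (⟪ξ, y⟫ : ℂ)) - 1
          - Complex.I * (if ‖y‖ ≤ 1 then (⟪ξ, y⟫ : ℂ) else 0)) ∂ν)
    -- (p t) are the marginal laws of the associated Lévy process
    (p : ℝ → Measure (EuclideanSpace ℝ (Fin d)))
    (hp : ∀ t, 0 ≤ t → IsProbabilityMeasure (p t))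
    (hchar : ∀ t, 0 ≤ t → ∀ ξ,
      ∫ x, Complex.exp (Complex.I * (⟪ξ, x⟫ : ℂ)) ∂(p t)
        = Complex.exp (-(t : ℂ) * ψ ξ))
    -- g bounded Borel, μ a finite Borel measure
    (g : EuclideanSpace ℝ (Fin d) → ℝ) (hgm : Measurable g)
    (Cg : ℝ) (hgbd : ∀ x, |g x| ≤ Cg)
    (μ : Measure (EuclideanSpace ℝ (Fin d))) (hμ : IsFiniteMeasure μ)
    -- r = g ∗ μ̌ is bounded and continuous, differentiable at 0 with gradient ∇r(0)
    (r : EuclideanSpace ℝ (Fin d) → ℝ)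
    (hr : ∀ x, r x = ∫ y, g (x + y) ∂μ)
    (hrc : Continuous r) (Mr : ℝ) (hrbd : ∀ x, |r x| ≤ Mr)
    (gradr0 : EuclideanSpace ℝ (Fin d))
    (hgrad : HasGradientAt r gradr0 0)
    (C : ℝ) (hC : 0 < C)
    (hrH : ∀ x : EuclideanSpace ℝ (Fin d), ‖x‖ < 1 →
      |r x - r 0 - ⟪x, gradr0⟫| ≤ C * ‖x‖ ^ β) :
    Integrable
      (fun x : EuclideanSpace ℝ (Fin d) =>
        r x - r 0 - (if ‖x‖ ≤ 1 then ⟪x, gradr0⟫ else 0)) ν ∧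
      Tendsto (fun t : ℝ => t⁻¹ * ((∫ y, r y ∂(p t)) - r 0)) (𝓝[>] 0)
        (𝓝 (⟪γ, gradr0⟫ +
          ∫ x, (r x - r 0 - (if ‖x‖ ≤ 1 then ⟪x, gradr0⟫ else 0)) ∂ν)) := by
  have hβ0 : 0 < β := by linarith
  have hD := integrable_min_one_rpow_of_lintegral_lt_top hνlevy hνβ
  have hν2 := integrable_min_one_norm_sq hβ2.le hβ0 hD
  have := sigmaFinite_of_integrable_min hν0 hν2
  obtain rfl : ψ = levyExponent ν γ := funext hψ
  set h : EuclideanSpace ℝ (Fin d) → ℝ := fun x => r x - r 0 - Real.sin ⟪gradr0, x⟫ with hh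
  have hhc : Continuous h := by fun_prop
  have hhM : ∀ x, |h x| ≤ 2 * Mr + 1 := fun x => by
    have h1 := abs_sub (r x - r 0) (Real.sin ⟪gradr0, x⟫)
    have h2 := abs_sub (r x) (r 0)
    linarith [hrbd x, hrbd 0, Real.abs_sin_le_one ⟪gradr0, x⟫]
  have hC' : 0 < C + 2 * ‖gradr0‖ ^ 2 := by positivity
  have hhβ : ∀ x, ‖x‖ < 1 → |h x| ≤ (C + 2 * ‖gradr0‖ ^ 2) * ‖x‖ ^ β := fun x hx =>
    abs_sub_sub_sin_le hβ2.le hx hβ0 (by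
      rw [real_inner_comm]
      exact hrH x hx)
  have hhint : Integrable h ν :=
    integrable_of_abs_le_rpow_near_zero hβ0 hD hhc.aestronglyMeasurable hC'.le hhM hhβ
  have hsin : Integrable (fun x : EuclideanSpace ℝ (Fin d) =>
      Real.sin ⟪gradr0, x⟫ - (if ‖x‖ ≤ 1 then ⟪gradr0, x⟫ else 0)) ν :=
    (integrable_levyKernel hν2 gradr0).im.congr (.of_forall fun x => levyKernel_im gradr0 x)
  have hsum : (fun x : EuclideanSpace ℝ (Fin d) =>
      r x - r 0 - (if ‖x‖ ≤ 1 then ⟪x, gradr0⟫ else 0)) =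
      fun x => h x + (Real.sin ⟪gradr0, x⟫ - (if ‖x‖ ≤ 1 then ⟪gradr0, x⟫ else 0)) := by
    funext x
    rw [real_inner_comm, hh]
    ring
  rw [hsum]
  refine ⟨hhint.add hsin, ?_⟩
  rw [integral_add hhint hsin, add_left_comm, real_inner_comm]
  refine tendsto_of_seq_tendsto fun s hs => ?_
  obtain ⟨hs0, hspos⟩ := tendsto_nhdsWithin_iff.1 hs
  obtain ⟨N, hN⟩ := eventually_atTop.1 hspos
  refine (tendsto_add_atTop_iff_nat N).1 ?_
  have ht0 : ∀ n, 0 < s (n + N) := fun n => hN _ (Nat.le_add_left _ _)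
  have ht : Tendsto (fun n => s (n + N)) atTop (𝓝 0) := (tendsto_add_atTop_iff_nat N).2 hs0
  have hprob : ∀ n, IsProbabilityMeasure (p (s (n + N))) := fun n => hp _ (ht0 n).le
  have hP := fun n => hchar _ (ht0 n).le
  have hsmall : ∀ ε : ℝ, 0 < ε → ∃ δ : ℝ, 0 < δ ∧ ∀ n,
      ∫⁻ x in {x | ‖x‖ ≤ δ}, ENNReal.ofReal |h x| ∂(p (s (n + N))) ≤
        ENNReal.ofReal (ε * s (n + N)) := fun ε hε => by
    obtain ⟨δ, hδ, hδ'⟩ := exists_setLIntegral_abs_le (γ := γ) hβ1 hβ2 hD hC' hhβ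
      (isLittleO_sub_sub_sin hgrad) hε
    exact ⟨δ, hδ, fun n => hδ' _ (ht0 n) _ (hP n)⟩
  refine ((tendsto_inv_mul_integral_of_small_near_zero hν2 ht0 ht hP hhc hhM (by simp [hh])
    hhint hsmall).add (tendsto_inv_mul_integral_sin hν2 ht0 ht hP gradr0)).congr fun n => ?_
  have hr_int : Integrable r (p (s (n + N))) :=
    Integrable.of_bound hrc.aestronglyMeasurable Mr (.of_forall hrbd)
  have hsin_int : Integrable (fun x => Real.sin ⟪gradr0, x⟫) (p (s (n + N))) :=
    Integrable.of_bound (by fun_prop) 1 (.of_forall fun x => Real.abs_sin_le_one _)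
  have hr_sub : Integrable (fun x => r x - r 0) (p (s (n + N))) :=
    hr_int.sub (integrable_const _)
  simp only [hh, Function.comp_apply]
  rw [← mul_add, integral_sub hr_sub hsin_int, sub_add_cancel,
    integral_sub hr_int (integrable_const _), integral_const, probReal_univ, one_smul]
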